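/- arXiv:math/0107163 — 7 statements merged into one kernel-verified Lean document; each statement's English description precedes it below -/
import Mathlib

section
/- Let ⟨G, A, ∘, 1, η, φ, χ⟩ be a G-Frobenius algebra and A^G its subspace of G-invariants. Then the restriction of η to A^G ⊗ A^G is non-degenerate if and only if ∑_{g∈G} χ_g⁻² = |G|. (Consequently A^G with the induced structures is a Frobenius algebra exactly in this case.) -/
/-- A `G`-twisted Frobenius algebra (G-Frobenius algebra) over a field `k`. -/
structure GFrobenius (k G A : Type*)
    [Field k] [Group G] [DecidableEq G] [AddCommGroup A] [Module k A] where
  grade : G → Submodule k A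
  internal : DirectSum.IsInternal grade
  finite : FiniteDimensional k A
  mul : A →ₗ[k] A →ₗ[k] A
  one : A
  eta : A →ₗ[k] A →ₗ[k] k
  phi : G → A →ₗ[k] A
  chi : G → k
  one_mem : one ∈ grade 1
  mul_mem : ∀ g h : G, ∀ a ∈ grade g, ∀ b ∈ grade h, mul a b ∈ grade (g * h)
  mul_assoc' : ∀ a b c : A, mul (mul a b) c = mul a (mul b c)
  twisted_comm : ∀ g h : G, ∀ a ∈ grade g, ∀ b ∈ grade h, mul a b = mul (phi g b) a
  one_mul' : ∀ a : A, mul one a = a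
  mul_one' : ∀ a : A, mul a one = a
  phi_id : phi 1 = LinearMap.id
  phi_comp : ∀ g h : G, phi (g * h) = (phi g).comp (phi h)
  phi_fixes_one : ∀ g : G, phi g one = one
  eta_nondeg_left : ∀ a : A, (∀ b : A, eta a b = 0) → a = 0
  eta_nondeg_right : ∀ b : A, (∀ a : A, eta a b = 0) → b = 0
  eta_grade : ∀ g h : G, g * h ≠ 1 → ∀ a ∈ grade g, ∀ b ∈ grade h, eta a b = 0
  eta_invariant : ∀ a b c : A, eta a (mul b c) = eta (mul a b) c
  chi_one : chi 1 = 1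
  chi_mul : ∀ g h : G, chi (g * h) = chi g * chi h
  chi_ne : ∀ g : G, chi g ≠ 0
  phi_grade : ∀ g h : G, ∀ a ∈ grade h, phi g a ∈ grade (g * h * g⁻¹)
  phi_self : ∀ g : G, ∀ a ∈ grade g, phi g a = (chi g)⁻¹ • a
  phi_mul : ∀ (g : G) (a b : A), phi g (mul a b) = mul (phi g a) (phi g b)
  phi_eta : ∀ (g : G) (a b : A), eta (phi g a) (phi g b) = ((chi g) ^ 2)⁻¹ * eta a b
  trace_axiom : ∀ g h : G, ∀ c ∈ grade (g * h * g⁻¹ * h⁻¹),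
    ∀ (hf : ∀ x ∈ grade g, ((mul c).comp (phi h)) x ∈ grade g)
      (hg : ∀ x ∈ grade h, ((phi g⁻¹).comp (mul c)) x ∈ grade h),
      chi h * LinearMap.trace k ↥(grade g) (((mul c).comp (phi h)).restrict hf)
        = chi g⁻¹ * LinearMap.trace k ↥(grade h) (((phi g⁻¹).comp (mul c)).restrict hg)

/-- A special `G`-Frobenius algebra: all twisted sectors are cyclic `A_e`-modules
with chosen generators `1_g` and sections `i_g`. -/
structure SpecialGFrobenius (k G A : Type*)
    [Field k] [Group G] [DecidableEq G] [AddCommGroup A] [Module k A]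
    extends GFrobenius k G A where
  oneg : G → A
  oneg_mem : ∀ g : G, oneg g ∈ grade g
  oneg_one : oneg 1 = one
  oneg_ne : ∀ g : G, oneg g ≠ 0
  iota : G → A →ₗ[k] A
  iota_mem : ∀ g : G, ∀ x ∈ grade g, iota g x ∈ grade 1
  iota_section : ∀ g : G, ∀ x ∈ grade g, mul (iota g x) (oneg g) = x
  iota_module : ∀ g : G, ∀ a ∈ grade 1, ∀ b ∈ grade g,
      iota g (mul a b) = mul (iota g (mul a (oneg g))) (iota g b)
  phiScalar : G → G → k
  phi_oneg : ∀ g h : G, phi g (oneg h) = phiScalar g h • oneg (g * h * g⁻¹)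
  phiScalar_one : ∀ g : G, phiScalar g 1 = 1

namespace SpecialGFrobenius

variable {k G A : Type*} [Field k] [Group G] [DecidableEq G] [AddCommGroup A] [Module k A]

/-- The restriction map `r_g : a ↦ a ∘ 1_g`. -/
def r (S : SpecialGFrobenius k G A) (g : G) : A →ₗ[k] A := S.mul.flip (S.oneg g)

/-- The projection `π_g = i_g ∘ r_g`. -/
def proj (S : SpecialGFrobenius k G A) (g : G) : A →ₗ[k] A := (S.iota g).comp (S.r g)

/-- The cocycle `γ_{g,h} = i_{gh}(1_g ∘ 1_h)`. -/
def gam (S : SpecialGFrobenius k G A) (g h : G) : A :=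
  S.iota (g * h) (S.mul (S.oneg g) (S.oneg h))

/-- The image `i_g(A_g) ⊆ A_e`. -/
def Bsub (S : SpecialGFrobenius k G A) (g : G) : Submodule k A :=
  (S.grade g).map (S.iota g)

end SpecialGFrobenius

open scoped BigOperators

namespace GFrobenius

variable {k G A : Type*} [Field k] [Group G] [DecidableEq G] [AddCommGroup A] [Module k A]

theorem one_ne_zero [Nontrivial A] (F : GFrobenius k G A) : F.one ≠ 0 := by
  intro h
  obtain ⟨a, ha⟩ := exists_ne (0 : A)
  apply ha
  rw [← F.one_mul' a, h, map_zero, LinearMap.zero_apply]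

variable [Fintype G]

/-- The sum over the group orbit is `G`-invariant. -/
theorem phi_sum_phi (F : GFrobenius k G A) (g : G) (a : A) :
    F.phi g (∑ h : G, F.phi h a) = ∑ h : G, F.phi h a := by
  rw [map_sum, ← Equiv.sum_comp (Equiv.mulLeft g) (fun h => F.phi h a)]
  refine Finset.sum_congr rfl fun h _ => ?_
  simp [F.phi_comp]

theorem eta_sum_phi_right (F : GFrobenius k G A) {a : A} (ha : ∀ g : G, F.phi g a = a) (b : A) :
    F.eta a (∑ g : G, F.phi g b) = (∑ g : G, ((F.chi g) ^ 2)⁻¹) * F.eta a b := by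
  rw [map_sum, Finset.sum_mul]
  refine Finset.sum_congr rfl fun g _ => ?_
  rw [← F.phi_eta, ha]

theorem eta_sum_phi_left (F : GFrobenius k G A) {b : A} (hb : ∀ g : G, F.phi g b = b) (a : A) :
    F.eta (∑ g : G, F.phi g a) b = (∑ g : G, ((F.chi g) ^ 2)⁻¹) * F.eta a b := by
  rw [map_sum, LinearMap.sum_apply, Finset.sum_mul]
  refine Finset.sum_congr rfl fun g _ => ?_
  rw [← F.phi_eta, hb]

end GFrobenius

/-- The restriction of `η` to the `G`-invariants `A^G` is non-degenerate if and
only if `∑_{g ∈ G} χ_g⁻² = |G|`. -/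
theorem invariants_eta_nondegenerate_iff_sum_chi
    {k G A : Type*} [Field k] [CharZero k] [Group G] [DecidableEq G] [Fintype G]
    [AddCommGroup A] [Module k A] [Nontrivial A] (F : GFrobenius k G A) :
    ((∀ a : A, (∀ g : G, F.phi g a = a) →
        (∀ b : A, (∀ g : G, F.phi g b = b) → F.eta a b = 0) → a = 0) ∧
     (∀ b : A, (∀ g : G, F.phi g b = b) →
        (∀ a : A, (∀ g : G, F.phi g a = a) → F.eta a b = 0) → b = 0))
      ↔ ∑ g : G, ((F.chi g) ^ 2)⁻¹ = (Fintype.card G : k) := by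
  constructor
  · rintro ⟨hl, -⟩
    obtain ⟨b, hb, hne⟩ : ∃ b : A, (∀ g : G, F.phi g b = b) ∧ F.eta F.one b ≠ 0 := by
      by_contra! h
      exact F.one_ne_zero (hl F.one F.phi_fixes_one h)
    have hchi : ∀ g : G, ((F.chi g) ^ 2)⁻¹ = 1 := fun g => by
      have h := F.phi_eta g F.one b
      rw [F.phi_fixes_one, hb] at h
      exact (eq_comm.trans (mul_eq_right₀ hne)).mp h
    simp [hchi]
  · intro hsum
    have hcard : (Fintype.card G : k) ≠ 0 := Nat.cast_ne_zero.mpr Fintype.card_ne_zero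
    refine ⟨fun a ha h => F.eta_nondeg_left a fun b => ?_,
      fun b hb h => F.eta_nondeg_right b fun a => ?_⟩
    · have h0 := h _ fun g => F.phi_sum_phi g b
      rw [F.eta_sum_phi_right ha, hsum] at h0
      exact (mul_eq_zero.mp h0).resolve_left hcard
    · have h0 := h _ fun g => F.phi_sum_phi g a
      rw [F.eta_sum_phi_left hb, hsum] at h0
      exact (mul_eq_zero.mp h0).resolve_left hcard
end

section
/- Let A be a special G-Frobenius algebra. For g ∈ G, equip the subspace i_g(A_g) ⊆ A_e with the multiplication a ∘_g b := π_g(a ∘ b) and the bilinear form η_g(a, b) := η(r_g(a'), r_{g⁻¹}(b')) where a = i_g(a''), etc., i.e. η_g(a,b) = ε(γ_{g,g⁻¹} ∘ π_g(a ∘ b)) with ε(x) := η(x,1). Then ⟨i_g(A_g), ∘_g, η_g, π_g(1)⟩ is a commutative associative Frobenius algebra with invariant non-degenerate form, and the pairing (a_g, b_{g⁻¹}) ↦ η(a_g, b_{g⁻¹}) establishes an isomorphism between i_g(A_g) and i_{g⁻¹}(A_{g⁻¹}) (equivalently, between A_g and the dual of A_{g⁻¹}). -/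
namespace GFrobenius

variable {k G A : Type*} [Field k] [Group G] [DecidableEq G] [AddCommGroup A] [Module k A]

/-- The untwisted sector is central. -/
lemma mul_comm_of_mem_grade_one (F : GFrobenius k G A) {h : G} {c x : A} (hc : c ∈ F.grade 1)
    (hx : x ∈ F.grade h) : F.mul c x = F.mul x c := by
  rw [F.twisted_comm 1 h c hc x hx, F.phi_id, LinearMap.id_apply]

lemma mul_mem_grade_of_mem_grade_one (F : GFrobenius k G A) {h : G} {c x : A}
    (hc : c ∈ F.grade 1) (hx : x ∈ F.grade h) : F.mul c x ∈ F.grade h := by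
  simpa using F.mul_mem 1 h c hc x hx

lemma eta_eq_eta_mul_one (F : GFrobenius k G A) (x y : A) :
    F.eta x y = F.eta (F.mul x y) F.one := by
  rw [← F.eta_invariant, F.mul_one']

/-- The form pairs `A_{h⁻¹}` and `A_h` non-degenerately on the right. -/
lemma eq_zero_of_forall_eta_eq_zero (F : GFrobenius k G A) {h : G} {y : A}
    (hy : y ∈ F.grade h⁻¹) (H : ∀ x ∈ F.grade h, F.eta x y = 0) : y = 0 := by
  refine F.eta_nondeg_right y fun x => ?_
  have hx : x ∈ ⨆ i, F.grade i := by
    rw [F.internal.submodule_iSup_eq_top]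
    trivial
  induction hx using Submodule.iSup_induction' with
  | mem i x hx =>
    by_cases hi : i = h
    · exact H x (hi ▸ hx)
    · exact F.eta_grade i h⁻¹ (fun e => hi (mul_inv_eq_one.mp e)) x hx y hy
  | zero => simp
  | add x y _ _ hx hy => simp [hx, hy]

end GFrobenius

namespace SpecialGFrobenius

variable {k G A : Type*} [Field k] [Group G] [DecidableEq G] [AddCommGroup A] [Module k A]

lemma r_apply (S : SpecialGFrobenius k G A) (g : G) (a : A) : S.r g a = S.mul a (S.oneg g) := rfl

lemma proj_apply (S : SpecialGFrobenius k G A) (g : G) (a : A) :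
    S.proj g a = S.iota g (S.r g a) := rfl

lemma r_mem (S : SpecialGFrobenius k G A) (g : G) {a : A} (ha : a ∈ S.grade 1) :
    S.r g a ∈ S.grade g :=
  S.mul_mem_grade_of_mem_grade_one ha (S.oneg_mem g)

lemma r_iota (S : SpecialGFrobenius k G A) (g : G) {x : A} (hx : x ∈ S.grade g) :
    S.r g (S.iota g x) = x :=
  S.iota_section g x hx

lemma proj_mem_Bsub (S : SpecialGFrobenius k G A) (g : G) {a : A} (ha : a ∈ S.grade 1) :
    S.proj g a ∈ S.Bsub g :=
  ⟨S.r g a, S.r_mem g ha, rfl⟩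

lemma mem_grade_one_of_mem_Bsub (S : SpecialGFrobenius k G A) {g : G} {a : A}
    (ha : a ∈ S.Bsub g) : a ∈ S.grade 1 := by
  obtain ⟨x, hx, rfl⟩ := ha
  exact S.iota_mem g x hx

lemma proj_eq_self (S : SpecialGFrobenius k G A) {g : G} {a : A} (ha : a ∈ S.Bsub g) :
    S.proj g a = a := by
  obtain ⟨x, hx, rfl⟩ := ha
  rw [proj_apply, S.r_iota g hx]

lemma mul_mem_grade_one (S : SpecialGFrobenius k G A) {a b : A}
    (ha : a ∈ S.grade 1) (hb : b ∈ S.grade 1) : S.mul a b ∈ S.grade 1 :=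
  S.mul_mem_grade_of_mem_grade_one ha hb

lemma proj_mul (S : SpecialGFrobenius k G A) (g : G) {a b : A}
    (ha : a ∈ S.grade 1) (hb : b ∈ S.grade 1) :
    S.proj g (S.mul a b) = S.mul (S.proj g a) (S.proj g b) := by
  rw [proj_apply, r_apply, S.mul_assoc']
  exact S.iota_module g a ha _ (S.r_mem g hb)

lemma proj_mul_of_mem_Bsub (S : SpecialGFrobenius k G A) {g : G} {a b : A}
    (ha : a ∈ S.Bsub g) (hb : b ∈ S.Bsub g) : S.proj g (S.mul a b) = S.mul a b := by
  rw [S.proj_mul g (S.mem_grade_one_of_mem_Bsub ha) (S.mem_grade_one_of_mem_Bsub hb),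
    S.proj_eq_self ha, S.proj_eq_self hb]

lemma mul_mem_Bsub (S : SpecialGFrobenius k G A) {g : G} {a b : A}
    (ha : a ∈ S.Bsub g) (hb : b ∈ S.Bsub g) : S.mul a b ∈ S.Bsub g := by
  rw [← S.proj_mul_of_mem_Bsub ha hb]
  exact S.proj_mem_Bsub g
    (S.mul_mem_grade_one (S.mem_grade_one_of_mem_Bsub ha) (S.mem_grade_one_of_mem_Bsub hb))

lemma gam_inv (S : SpecialGFrobenius k G A) (g : G) :
    S.gam g g⁻¹ = S.mul (S.oneg g) (S.oneg g⁻¹) := by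
  have h : S.mul (S.oneg g) (S.oneg g⁻¹) ∈ S.grade (g * g⁻¹) :=
    S.mul_mem _ _ _ (S.oneg_mem g) _ (S.oneg_mem g⁻¹)
  have hs := S.iota_section _ _ h
  rwa [mul_inv_cancel, S.oneg_one, S.mul_one', ← mul_inv_cancel g] at hs

lemma eta_r_r_inv (S : SpecialGFrobenius k G A) (g : G) (a : A) {b : A} (hb : b ∈ S.grade 1) :
    S.eta (S.r g a) (S.r g⁻¹ b)
      = S.eta (S.mul (S.mul a b) (S.mul (S.oneg g) (S.oneg g⁻¹))) S.one := by
  rw [S.eta_eq_eta_mul_one]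
  simp only [r_apply]
  rw [S.mul_assoc', ← S.mul_assoc' (S.oneg g) b,
    ← S.mul_comm_of_mem_grade_one hb (S.oneg_mem g)]
  simp only [S.mul_assoc']

/-- The annihilator of `1_g` is contained in that of `1_{g⁻¹}`. -/
lemma r_inv_eq_zero (S : SpecialGFrobenius k G A) {g : G} {c : A} (hc : c ∈ S.grade 1)
    (h : S.r g c = 0) : S.r g⁻¹ c = 0 := by
  refine S.eq_zero_of_forall_eta_eq_zero (S.r_mem g⁻¹ hc) fun x hx => ?_
  rw [← S.r_iota g hx, S.eta_r_r_inv g _ hc, S.mul_assoc', ← S.mul_assoc' c]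
  rw [r_apply] at h
  simp [h]

lemma proj_proj_inv (S : SpecialGFrobenius k G A) {g : G} {a : A} (ha : a ∈ S.Bsub g) :
    S.proj g (S.proj g⁻¹ a) = a := by
  have ha₁ := S.mem_grade_one_of_mem_Bsub ha
  have hp := S.mem_grade_one_of_mem_Bsub (S.proj_mem_Bsub g⁻¹ ha₁)
  have hr : S.r g⁻¹ (S.proj g⁻¹ a - a) = 0 := by
    rw [map_sub, proj_apply, S.r_iota g⁻¹ (S.r_mem g⁻¹ ha₁), sub_self]
  have hr' := S.r_inv_eq_zero (sub_mem hp ha₁) hr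
  rw [inv_inv, map_sub, sub_eq_zero] at hr'
  rw [proj_apply, hr']
  exact S.proj_eq_self ha

/-- The projections identify `i_g(A_g)` with `i_{g⁻¹}(A_{g⁻¹})`. -/
def bsubEquivInv (S : SpecialGFrobenius k G A) (g : G) : S.Bsub g ≃ₗ[k] S.Bsub g⁻¹ :=
  LinearEquiv.ofLinearMap
    ((S.proj g⁻¹).restrict fun _ ha => S.proj_mem_Bsub g⁻¹ (S.mem_grade_one_of_mem_Bsub ha))
    ((S.proj g).restrict fun _ ha => S.proj_mem_Bsub g (S.mem_grade_one_of_mem_Bsub ha))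
    (by
      ext b
      have hb : (b : A) ∈ S.Bsub g⁻¹ := b.2
      simpa using S.proj_proj_inv hb)
    (by
      ext a
      exact S.proj_proj_inv a.2)

lemma eq_zero_of_forall_eta_r_r_inv_eq_zero (S : SpecialGFrobenius k G A) {g : G} {b : A}
    (hb : b ∈ S.Bsub g) (h : ∀ a ∈ S.Bsub g, S.eta (S.r g a) (S.r g⁻¹ b) = 0) : b = 0 := by
  have hb₁ := S.mem_grade_one_of_mem_Bsub hb
  have hr : S.r g⁻¹ b = 0 :=
    S.eq_zero_of_forall_eta_eq_zero (S.r_mem g⁻¹ hb₁) fun x hx => by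
      rw [← S.r_iota g hx]
      exact h _ ⟨x, hx, rfl⟩
  have hr' := S.r_inv_eq_zero hb₁ hr
  rw [inv_inv] at hr'
  rw [← S.proj_eq_self hb, proj_apply, hr', map_zero]

end SpecialGFrobenius


open SpecialGFrobenius in
/-- for a special `G`-Frobenius algebra the subspace `i_g(A_g) ⊆ A_e` with the
multiplication `a ∘_g b = π_g(a∘b)`, unit `π_g(1)` and form
`η_g(a,b) = η(r_g a, r_{g⁻¹} b) = ε(γ_{g,g⁻¹} π_g(ab))` is a commutative associative Frobenius
algebra, and `η` establishes an isomorphism between `i_g(A_g)` and `i_{g⁻¹}(A_{g⁻¹})`. -/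
theorem twisted_sector_frobenius
    {k G A : Type*} [Field k] [CharZero k] [Group G] [DecidableEq G] [Fintype G]
    [AddCommGroup A] [Module k A] (S : SpecialGFrobenius k G A) (g : G) :
    (∀ a ∈ S.Bsub g, ∀ b ∈ S.Bsub g, S.proj g (S.mul a b) ∈ S.Bsub g) ∧
    (S.proj g S.one ∈ S.Bsub g) ∧
    (∀ a ∈ S.Bsub g, S.proj g (S.mul (S.proj g S.one) a) = a ∧
        S.proj g (S.mul a (S.proj g S.one)) = a) ∧
    (∀ a ∈ S.Bsub g, ∀ b ∈ S.Bsub g, S.proj g (S.mul a b) = S.proj g (S.mul b a)) ∧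
    (∀ a ∈ S.Bsub g, ∀ b ∈ S.Bsub g, ∀ c ∈ S.Bsub g,
        S.proj g (S.mul (S.proj g (S.mul a b)) c)
          = S.proj g (S.mul a (S.proj g (S.mul b c)))) ∧
    (∀ a ∈ S.Bsub g, ∀ b ∈ S.Bsub g,
        S.eta (S.r g a) (S.r g⁻¹ b)
          = S.eta (S.mul (S.gam g g⁻¹) (S.proj g (S.mul a b))) S.one) ∧
    (∀ a ∈ S.Bsub g, ∀ b ∈ S.Bsub g, ∀ c ∈ S.Bsub g,
        S.eta (S.r g (S.proj g (S.mul a b))) (S.r g⁻¹ c)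
          = S.eta (S.r g a) (S.r g⁻¹ (S.proj g (S.mul b c)))) ∧
    (∀ a ∈ S.Bsub g, (∀ b ∈ S.Bsub g, S.eta (S.r g a) (S.r g⁻¹ b) = 0) → a = 0) ∧
    (∀ b ∈ S.Bsub g, (∀ a ∈ S.Bsub g, S.eta (S.r g a) (S.r g⁻¹ b) = 0) → b = 0) ∧
    Nonempty (↥(S.Bsub g) ≃ₗ[k] ↥(S.Bsub g⁻¹)) := by
  have mem₁ : ∀ {a}, a ∈ S.Bsub g → a ∈ S.grade 1 := S.mem_grade_one_of_mem_Bsub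
  have comm : ∀ {a b}, a ∈ S.Bsub g → b ∈ S.Bsub g → S.mul a b = S.mul b a := fun ha hb =>
    S.mul_comm_of_mem_grade_one (mem₁ ha) (mem₁ hb)
  have unit_mul : ∀ a ∈ S.Bsub g, S.mul (S.proj g S.one) a = a := fun a ha => by
    conv_lhs => rw [← S.proj_eq_self ha]
    rw [← S.proj_mul g S.one_mem (mem₁ ha), S.one_mul', S.proj_eq_self ha]
  have unit_mem := S.proj_mem_Bsub g S.one_mem
  refine ⟨fun a ha b hb => ?_, unit_mem, fun a ha => ⟨?_, ?_⟩, fun a ha b hb => ?_,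
    fun a ha b hb c hc => ?_, fun a ha b hb => ?_, fun a ha b hb c hc => ?_,
    fun a ha h => ?_, fun b hb h => S.eq_zero_of_forall_eta_r_r_inv_eq_zero hb h,
    ⟨S.bsubEquivInv g⟩⟩
  · exact S.proj_mem_Bsub g (mem₁ (S.mul_mem_Bsub ha hb))
  · rw [unit_mul a ha, S.proj_eq_self ha]
  · rw [comm ha unit_mem, unit_mul a ha, S.proj_eq_self ha]
  · rw [comm ha hb]
  · rw [S.proj_mul_of_mem_Bsub ha hb, S.proj_mul_of_mem_Bsub hb hc, S.mul_assoc']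
  · have hγ : S.mul (S.oneg g) (S.oneg g⁻¹) ∈ S.grade (g * g⁻¹) :=
      S.mul_mem _ _ _ (S.oneg_mem g) _ (S.oneg_mem g⁻¹)
    rw [S.eta_r_r_inv g a (mem₁ hb), S.gam_inv, S.proj_mul_of_mem_Bsub ha hb,
      S.mul_comm_of_mem_grade_one (mem₁ (S.mul_mem_Bsub ha hb)) hγ]
  · rw [S.proj_mul_of_mem_Bsub ha hb, S.proj_mul_of_mem_Bsub hb hc,
      S.eta_r_r_inv g _ (mem₁ hc), S.eta_r_r_inv g _ (mem₁ (S.mul_mem_Bsub hb hc)),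
      S.mul_assoc' a b c]
  · refine S.eq_zero_of_forall_eta_r_r_inv_eq_zero ha fun b hb => ?_
    rw [S.eta_r_r_inv g b (mem₁ ha), comm hb ha, ← S.eta_r_r_inv g a (mem₁ hb)]
    exact h b hb
end

section
/- Let A be a special G-Frobenius algebra with scalars φ_{g,h} ∈ k defined by φ_g(1_h) = φ_{g,h}·1_{ghg⁻¹}. Then the φ_{g,h} form a non-abelian G 2-cocycle with values in k*: for all g, h, k ∈ G, φ_{gh,k} = φ_{g,hkh⁻¹} · φ_{h,k}, φ_{e,g} = φ_{g,e} = 1, and φ_{g⁻¹,ghg⁻¹} = φ_{g,h}⁻¹. -/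
namespace SpecialGFrobenius

variable {k G A : Type*} [Field k] [Group G] [DecidableEq G] [AddCommGroup A] [Module k A]

theorem phiScalar_one_left (S : SpecialGFrobenius k G A) (g : G) : S.phiScalar 1 g = 1 := by
  apply smul_left_injective k (S.oneg_ne g)
  simpa [S.phi_id] using (S.phi_oneg 1 g).symm

theorem phiScalar_mul (S : SpecialGFrobenius k G A) (g h l : G) :
    S.phiScalar (g * h) l = S.phiScalar g (h * l * h⁻¹) * S.phiScalar h l := by
  apply smul_left_injective k (S.oneg_ne (g * h * l * (g * h)⁻¹))
  have conj : g * (h * l * h⁻¹) * g⁻¹ = g * h * l * (g * h)⁻¹ := by group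
  have comp := S.phi_oneg (g * h) l
  rw [S.phi_comp, LinearMap.comp_apply, S.phi_oneg h, map_smul, S.phi_oneg g, conj, smul_smul,
    mul_comm] at comp
  exact comp.symm

end SpecialGFrobenius

/-- the scalars `φ_{g,h}` of a special `G`-Frobenius algebra (defined by
`φ_g(1_h) = φ_{g,h}·1_{ghg⁻¹}`) form a non-abelian `G` 2-cocycle with values in `k*`. -/
theorem phiScalar_is_nonabelian_cocycle
    {k G A : Type*} [Field k] [CharZero k] [Group G] [DecidableEq G] [Fintype G]
    [AddCommGroup A] [Module k A] (S : SpecialGFrobenius k G A) :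
    (∀ g h : G, S.phiScalar g h ≠ 0) ∧
    (∀ g h l : G, S.phiScalar (g * h) l = S.phiScalar g (h * l * h⁻¹) * S.phiScalar h l) ∧
    (∀ g : G, S.phiScalar 1 g = 1 ∧ S.phiScalar g 1 = 1) ∧
    (∀ g h : G, S.phiScalar g⁻¹ (g * h * g⁻¹) = (S.phiScalar g h)⁻¹) := by
  have mul_eq : ∀ g h l : G,
      S.phiScalar (g * h) l = S.phiScalar g (h * l * h⁻¹) * S.phiScalar h l :=
    S.phiScalar_mul
  have one_left := S.phiScalar_one_left
  have inv_mul : ∀ g h : G, S.phiScalar g⁻¹ (g * h * g⁻¹) * S.phiScalar g h = 1 := fun g h => by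
    rw [← mul_eq, inv_mul_cancel, one_left]
  exact ⟨fun g h => right_ne_zero_of_mul_eq_one (inv_mul g h), mul_eq,
    fun g => ⟨one_left g, S.phiScalar_one g⟩, fun g h => eq_inv_of_mul_eq_one_left (inv_mul g h)⟩
end

section
/- Let A be a special G-Frobenius algebra with cocycles γ and (φ_{g,h}) as above. Then: (1) for every g ∈ G, if χ_g ≠ 1 then γ_{g,g} = 0; (2) for every commuting pair g, h ∈ G (gh = hg), either φ_{g,h}·φ_{h,g} = 1 or γ_{g,h} = γ_{h,g} = 0; (3) if 1_g ∘ 1_h ∘ 1_k ≠ 0, then the compatibility relation φ_{gh,k} = φ_{g,hkh⁻¹}·φ_{h,k} holds automatically. -/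
namespace SpecialGFrobenius

variable {k G A : Type*} [Field k] [Group G] [DecidableEq G] [AddCommGroup A] [Module k A]

theorem mul_oneg_self (S : SpecialGFrobenius k G A) (g : G) :
    S.mul (S.oneg g) (S.oneg g) = (S.chi g)⁻¹ • S.mul (S.oneg g) (S.oneg g) := by
  conv_lhs => rw [S.twisted_comm g g _ (S.oneg_mem g) _ (S.oneg_mem g),
    S.phi_self g _ (S.oneg_mem g), map_smul, LinearMap.smul_apply]

theorem mul_oneg_of_commute (S : SpecialGFrobenius k G A) {g h : G} (hc : g * h = h * g) :
    S.mul (S.oneg g) (S.oneg h) = S.phiScalar g h • S.mul (S.oneg h) (S.oneg g) := by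
  rw [S.twisted_comm g h _ (S.oneg_mem g) _ (S.oneg_mem h), S.phi_oneg,
    mul_inv_eq_of_eq_mul hc, map_smul, LinearMap.smul_apply]

end SpecialGFrobenius

/-- in a special `G`-Frobenius algebra: (1) `γ_{g,g} = 0` unless `χ_g = 1`;
(2) for commuting `g, h` either `φ_{g,h}φ_{h,g} = 1` or `γ_{g,h} = γ_{h,g} = 0`;
(3) if `1_g ∘ 1_h ∘ 1_k ≠ 0` then the non-abelian cocycle relation for `φ` holds
automatically. -/
theorem special_cocycle_conditions
    {k G A : Type*} [Field k] [CharZero k] [Group G] [DecidableEq G] [Fintype G]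
    [AddCommGroup A] [Module k A] (S : SpecialGFrobenius k G A) :
    (∀ g : G, S.chi g ≠ 1 → S.gam g g = 0) ∧
    (∀ g h : G, g * h = h * g →
        (S.phiScalar g h * S.phiScalar h g = 1 ∨ (S.gam g h = 0 ∧ S.gam h g = 0))) ∧
    (∀ g h l : G, S.mul (S.mul (S.oneg g) (S.oneg h)) (S.oneg l) ≠ 0 →
        S.phiScalar (g * h) l = S.phiScalar g (h * l * h⁻¹) * S.phiScalar h l) := by
  refine ⟨fun g hg => ?_, fun g h hc => ?_, fun g h l _ => S.phiScalar_mul g h l⟩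
  · have hz : S.mul (S.oneg g) (S.oneg g) = 0 := by
      by_contra hne
      have := smul_left_injective k hne
        ((one_smul k _).trans (S.mul_oneg_self g))
      exact hg (inv_eq_one.mp this.symm)
    rw [SpecialGFrobenius.gam, hz, map_zero]
  · have hgh := S.mul_oneg_of_commute hc
    have hhg := S.mul_oneg_of_commute hc.symm
    by_cases hz : S.mul (S.oneg g) (S.oneg h) = 0
    · right
      rw [SpecialGFrobenius.gam, SpecialGFrobenius.gam, hhg, hz, smul_zero, map_zero, map_zero]
      exact ⟨rfl, rfl⟩
    · left
      rw [hhg, smul_smul] at hgh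
      exact (smul_left_injective k hz ((one_smul k _).trans hgh)).symm
end

section
/- Let A be a special G-Frobenius algebra with cocycle γ defined by 1_g ∘ 1_h = γ_{g,h} ∘ 1_{gh}. If γ_{g,h} = 0 for some g, h ∈ G, then π_h(γ_{g,g⁻¹}) = 0 and π_g(γ_{h,h⁻¹}) = 0. -/
namespace SpecialGFrobenius

variable {k G A : Type*} [Field k] [Group G] [DecidableEq G] [AddCommGroup A] [Module k A]
  (S : SpecialGFrobenius k G A) (g h : G)

theorem mul_oneg_mem : S.mul (S.oneg g) (S.oneg h) ∈ S.grade (g * h) :=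
  S.mul_mem g h _ (S.oneg_mem g) _ (S.oneg_mem h)

/-- The defining relation `γ_{g,h} ∘ 1_{gh} = 1_g ∘ 1_h` of the cocycle. -/
theorem gam_mul_oneg :
    S.mul (S.gam g h) (S.oneg (g * h)) = S.mul (S.oneg g) (S.oneg h) :=
  S.iota_section (g * h) _ (S.mul_oneg_mem g h)

theorem gam_inv_right : S.gam g g⁻¹ = S.mul (S.oneg g) (S.oneg g⁻¹) := by
  rw [← S.gam_mul_oneg, mul_inv_cancel, S.oneg_one, S.mul_one']

/-- Elements of the untwisted sector are central. -/
theorem mul_comm_of_mem_grade_one {a b : A} (ha : a ∈ S.grade 1) (hb : b ∈ S.grade h) :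
    S.mul a b = S.mul b a := by
  rw [S.twisted_comm 1 h a ha b hb, S.phi_id, LinearMap.id_apply]

theorem oneg_mul_oneg_inv : S.mul (S.oneg g) (S.oneg g⁻¹) =
    S.phiScalar g g⁻¹ • S.mul (S.oneg g⁻¹) (S.oneg g) := by
  rw [S.twisted_comm g g⁻¹ _ (S.oneg_mem g) _ (S.oneg_mem g⁻¹), S.phi_oneg, mul_inv_cancel,
    one_mul, map_smul, LinearMap.smul_apply]

end SpecialGFrobenius

/-- if `γ_{g,h} = 0` in a special `G`-Frobenius algebra, then
`π_h(γ_{g,g⁻¹}) = 0` and `π_g(γ_{h,h⁻¹}) = 0`. -/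
theorem proj_gamma_vanishes_of_gamma_zero
    {k G A : Type*} [Field k] [CharZero k] [Group G] [DecidableEq G] [Fintype G]
    [AddCommGroup A] [Module k A] (S : SpecialGFrobenius k G A)
    (g h : G) (hz : S.gam g h = 0) :
    S.proj h (S.gam g g⁻¹) = 0 ∧ S.proj g (S.gam h h⁻¹) = 0 := by
  have hgh : S.mul (S.oneg g) (S.oneg h) = 0 := by
    rw [← S.gam_mul_oneg, hz, map_zero, LinearMap.zero_apply]
  constructor
  · change S.iota h (S.mul (S.gam g g⁻¹) (S.oneg h)) = 0
    rw [S.gam_inv_right, S.oneg_mul_oneg_inv, map_smul, LinearMap.smul_apply, S.mul_assoc', hgh,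
      map_zero, smul_zero, map_zero]
  · change S.iota g (S.mul (S.gam h h⁻¹) (S.oneg g)) = 0
    have hmem : S.mul (S.oneg h) (S.oneg h⁻¹) ∈ S.grade 1 := by
      simpa only [mul_inv_cancel] using S.mul_oneg_mem h h⁻¹
    rw [S.gam_inv_right, S.mul_comm_of_mem_grade_one g hmem (S.oneg_mem g), ← S.mul_assoc', hgh,
      map_zero, LinearMap.zero_apply, map_zero]
end

section
/- Let f ∈ ℂ[x₁,…,xₙ] be a quasi-homogeneous polynomial of type (q₁,…,qₙ) with rational weights 0 < q_i < 1 (i.e. f(λ^{q₁}x₁,…,λ^{qₙ}xₙ) = λ f(x₁,…,xₙ)), and suppose the Milnor ring A_e := ℂ[x₁,…,xₙ]/(∂f/∂x₁,…,∂f/∂xₙ) is finite-dimensional. Let g = diag(μ₁,…,μₙ) be a diagonal linear transformation of finite order with f ∘ g = f, so g induces an algebra automorphism φ_g of A_e. Then the trace of φ_g on A_e equals ∏_{i : μ_i ≠ 1} (−μ_i⁻¹) · ∏_{i : μ_i = 1} (1/q_i − 1); in particular, Tr(φ_g|_{A_e}) = (−1)^{|N_g|} det(g)⁻¹ · dim A_g,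 where N_g = {i : μ_i ≠ 1} and A_g is the Milnor ring of the restriction of f to the fixed subspace {x_i = 0 : i ∈ N_g}, whose dimension is ∏_{i : μ_i = 1}(1/q_i − 1). -/
open MvPolynomial
open scoped BigOperators Classical

open RingTheory.Sequence IsLocalRing in
/-- In a system of parameters, `h` may be replaced by any `c` avoiding the non-maximal minimal
primes of the ideal generated by the other parameters. -/
lemma maximalIdeal_le_radical_sup_span_of_avoid {R : Type*} [CommRing R] [IsLocalRing R]
    [IsNoetherianRing R] {I : Ideal R} {h c : R}
    (hI : maximalIdeal R ≤ (I ⊔ Ideal.span {h}).radical) (hh : h ∈ maximalIdeal R)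
    (hc : ∀ p ∈ I.minimalPrimes, p ≠ maximalIdeal R → c ∉ p) :
    maximalIdeal R ≤ (I ⊔ Ideal.span {c}).radical := by
  rw [Ideal.radical_eq_sInf]
  refine le_sInf fun q ⟨hIq, hq⟩ => ?_
  obtain ⟨p, hp, hpq⟩ := Ideal.exists_minimalPrimes_le (le_sup_left.trans hIq)
  have hcq : c ∈ q := hIq (Ideal.mem_sup_right (Ideal.mem_span_singleton_self c))
  by_cases hpm : p = maximalIdeal R
  · exact hpm ▸ hpq
  have hcp := hc p hp hpm
  by_contra hmq
  have := hp.isPrime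
  have hmin : maximalIdeal R ∈ (p ⊔ Ideal.span {h}).minimalPrimes := by
    refine ⟨⟨inferInstance, ?_⟩, fun r ⟨hr, hr'⟩ _ => ?_⟩
    · exact sup_le (le_maximalIdeal hp.isPrime.ne_top) ((Ideal.span_singleton_le_iff_mem _).2 hh)
    · exact hI.trans (hr.radical_le_iff.2 ((sup_le_sup_right hp.1.2 _).trans hr'))
  have h1 := Ideal.map_height_le_one_of_mem_minimalPrimes hmin
  have hpm' : p ≤ maximalIdeal R := le_maximalIdeal hp.isPrime.ne_top
  have hqm' : q ≤ maximalIdeal R := le_maximalIdeal hq.ne_top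
  have hmP : ((maximalIdeal R).map (Ideal.Quotient.mk p)).IsPrime :=
    Ideal.map_isPrime_of_surjective Ideal.Quotient.mk_surjective (by simpa using hpm')
  have hqP : (q.map (Ideal.Quotient.mk p)).IsPrime :=
    Ideal.map_isPrime_of_surjective Ideal.Quotient.mk_surjective (by simpa using hpq)
  have hlt : q.map (Ideal.Quotient.mk p) < (maximalIdeal R).map (Ideal.Quotient.mk p) := by
    refine lt_of_le_not_ge (Ideal.map_mono hqm') fun hle => hmq ?_
    have := Ideal.comap_mono (f := Ideal.Quotient.mk p) hle
    rwa [Ideal.comap_map_of_surjective _ Ideal.Quotient.mk_surjective,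
      Ideal.comap_map_of_surjective _ Ideal.Quotient.mk_surjective, ← RingHom.ker_eq_comap_bot,
      Ideal.mk_ker, sup_eq_left.2 hpm', sup_eq_left.2 hpq] at this
  have h2 := (Ideal.height_le_iff (n := 1)).1 (by exact_mod_cast h1) _ hqP hlt
  have h3 : (q.map (Ideal.Quotient.mk p)).height = 0 := by simpa using h2
  rw [Ideal.height_eq_zero_iff_eq_bot, Ideal.map_eq_bot_iff_le_ker, Ideal.mk_ker] at h3
  exact hcp (h3 hcq)

open RingTheory.Sequence IsLocalRing in
lemma RingTheory.Sequence.IsWeaklyRegular.concat_of_pow_mem {R M : Type*} [CommRing R]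
    [AddCommGroup M] [Module R M] {xs : List R} {x c : R}
    (hx : IsWeaklyRegular M (xs ++ [x]))
    (hc : x ∈ (Ideal.ofList xs ⊔ Module.annihilator R M ⊔ Ideal.span {c}).radical) :
    IsWeaklyRegular M (xs ++ [c]) := by
  rw [isWeaklyRegular_append_iff, isWeaklyRegular_singleton_iff] at hx ⊢
  refine ⟨hx.1, ?_⟩
  rw [isSMulRegular_iff_right_eq_zero_of_smul]
  obtain ⟨k, hk⟩ := hc
  obtain ⟨y, hy, z, hz, hyz⟩ := Submodule.mem_sup.1 hk
  obtain ⟨i, hi, a, ha, rfl⟩ := Submodule.mem_sup.1 hy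
  obtain ⟨r, rfl⟩ := Ideal.mem_span_singleton'.1 hz
  intro v hv
  refine (hx.2.pow k).right_eq_zero_of_smul ?_
  obtain ⟨v, rfl⟩ := Submodule.mkQ_surjective _ v
  rw [← hyz, add_smul, add_smul, mul_smul, hv, smul_zero, add_zero, ← map_smul, ← map_smul,
    Module.mem_annihilator.1 ha v, map_zero, add_zero]
  exact (Submodule.Quotient.mk_eq_zero _).2 (Submodule.smul_mem_smul hi trivial)

open RingTheory.Sequence IsLocalRing in
theorem RingTheory.Sequence.IsWeaklyRegular.of_length_eq_of_maximalIdeal_le_radical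
    {R : Type*} [CommRing R] [IsLocalRing R] [IsNoetherianRing R] {M : Type*} [AddCommGroup M]
    [Module R M] [IsNoetherian R M] {xs hs : List R} (hlen : xs.length = hs.length)
    (hxm : ∀ x ∈ xs, x ∈ maximalIdeal R) (hhm : ∀ h ∈ hs, h ∈ maximalIdeal R)
    (hx : maximalIdeal R ≤ (Ideal.ofList xs ⊔ Module.annihilator R M).radical)
    (hh : maximalIdeal R ≤ (Ideal.ofList hs ⊔ Module.annihilator R M).radical)
    (hreg : IsWeaklyRegular M xs) : IsWeaklyRegular M hs := by
  induction xs generalizing hs M with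
  | nil =>
    obtain rfl : hs = [] := List.length_eq_zero_iff.1 hlen.symm
    exact .nil R M
  | cons x xs ih =>
    cases hs with
    | nil => simp at hlen
    | cons h hs =>
    simp only [List.length_cons, add_left_inj, List.mem_cons, forall_eq_or_imp] at hlen hxm hhm
    set A := Module.annihilator R M with hA
    obtain ⟨c, hcm, hcx, hch⟩ : ∃ c ∈ maximalIdeal R,
        (∀ p ∈ (Ideal.ofList xs ⊔ A).minimalPrimes, p ≠ maximalIdeal R → c ∉ p) ∧
        (∀ p ∈ (Ideal.ofList hs ⊔ A).minimalPrimes, p ≠ maximalIdeal R → c ∉ p) := by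
      let S : Set (Ideal R) := ((Ideal.ofList xs ⊔ A).minimalPrimes ∪
        (Ideal.ofList hs ⊔ A).minimalPrimes) \ {maximalIdeal R}
      have hS : S.Finite := ((Ideal.finite_minimalPrimes_of_isNoetherianRing R _).union
        (Ideal.finite_minimalPrimes_of_isNoetherianRing R _)).sdiff
      have hSp : ∀ p ∈ S, p.IsPrime := by
        rintro p ⟨hp | hp, -⟩ <;> exact hp.isPrime
      have := (Ideal.subset_iUnion_iff_mem_of_isMaximal_of_finite (M := maximalIdeal R)
        hS ⊥ ⊥ (fun p hp _ _ => hSp p hp) bot_ne_top bot_ne_top).not.2 (fun h => h.2 rfl)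
      obtain ⟨c, hc, hc'⟩ := Set.not_subset.1 this
      simp only [Set.mem_iUnion, not_exists] at hc'
      exact ⟨c, hc, fun p hp hpm hcp => hc' p ⟨Or.inl hp, hpm⟩ hcp,
        fun p hp hpm hcp => hc' p ⟨Or.inr hp, hpm⟩ hcp⟩
    rw [Ideal.ofList_cons, sup_comm (Ideal.span _), sup_right_comm] at hx hh
    have hxc := maximalIdeal_le_radical_sup_span_of_avoid hx hxm.1 hcx
    have hhc := maximalIdeal_le_radical_sup_span_of_avoid hh hhm.1 hch
    have hxreg : IsWeaklyRegular M (c :: xs) := by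
      refine isWeaklyRegular_of_perm_of_subset_maximalIdeal
        (IsWeaklyRegular.concat_of_pow_mem (x := x)
          (isWeaklyRegular_of_perm_of_subset_maximalIdeal hreg
            (List.perm_append_singleton x xs).symm ?_) (hxc hxm.1))
        (List.perm_append_singleton c xs) ?_
      · simpa [or_imp, forall_and] using hxm
      · simpa [or_imp, forall_and] using And.intro hxm.2 hcm
    have hle (ys : List R) : Ideal.ofList ys ⊔ A ⊔ Ideal.span {c} ≤
        Ideal.ofList ys ⊔ Module.annihilator R (QuotSMulTop c M) := by
      refine sup_le (sup_le_sup_left ?_ _) (le_sup_of_le_right ?_)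
      · exact LinearMap.annihilator_le_of_surjective _ (Submodule.mkQ_surjective _)
      · rw [Ideal.span_singleton_le_iff_mem, Module.mem_annihilator]
        intro v
        obtain ⟨v, rfl⟩ := Submodule.mkQ_surjective _ v
        rw [← map_smul]
        exact (Submodule.Quotient.mk_eq_zero _).2 (Submodule.smul_mem_pointwise_smul _ _ _ trivial)
    rw [isWeaklyRegular_cons_iff] at hxreg
    have hhreg : IsWeaklyRegular M (c :: hs) := by
      rw [isWeaklyRegular_cons_iff]
      exact ⟨hxreg.1, ih hlen hxm.2 hhm.2 (hxc.trans (Ideal.radical_mono (hle xs)))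
        (hhc.trans (Ideal.radical_mono (hle hs))) hxreg.2⟩
    refine isWeaklyRegular_of_perm_of_subset_maximalIdeal
        (IsWeaklyRegular.concat_of_pow_mem (x := c)
          (isWeaklyRegular_of_perm_of_subset_maximalIdeal hhreg
            (List.perm_append_singleton c hs).symm ?_) (hh hcm))
        (List.perm_append_singleton h hs) ?_
    · simpa [or_imp, forall_and] using And.intro hcm hhm.2
    · simpa [or_imp, forall_and] using hhm.symm

/-- Additivity of the trace along a short exact sequence. -/
lemma LinearMap.trace_eq_add_of_exact {K A B C : Type*} [Field K] [AddCommGroup A] [Module K A]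
    [AddCommGroup B] [Module K B] [AddCommGroup C] [Module K C] [FiniteDimensional K A]
    [FiniteDimensional K B] [FiniteDimensional K C]
    {i : A →ₗ[K] B} {q : B →ₗ[K] C} (hi : Function.Injective i) (hq : Function.Surjective q)
    (hiq : Function.Exact i q) {a : A →ₗ[K] A} {b : B →ₗ[K] B} {c : C →ₗ[K] C}
    (hab : i ∘ₗ a = b ∘ₗ i) (hbc : q ∘ₗ b = c ∘ₗ q) :
    trace K B b = trace K A a + trace K C c := by
  obtain ⟨s, hs⟩ := q.exists_rightInverse_of_surjective (range_eq_top.2 hq)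
  obtain ⟨r, hr⟩ := i.exists_leftInverse_of_injective (ker_eq_bot.2 hi)
  have hid : b = i ∘ₗ (r ∘ₗ b - r ∘ₗ s ∘ₗ q ∘ₗ b) + s ∘ₗ (q ∘ₗ b) := by
    ext x
    obtain ⟨y, hy⟩ := (hiq (b x - s (q (b x)))).1 (by
      rw [map_sub, sub_eq_zero]; exact (congr_fun (congr_arg DFunLike.coe hs) _).symm)
    have := congr_fun (congr_arg DFunLike.coe hr) y
    simp only [comp_apply, id_apply] at this
    simp only [add_apply, comp_apply, sub_apply]
    rw [← map_sub, ← hy, this, hy, sub_add_cancel]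
  have h1 : (r ∘ₗ b - r ∘ₗ s ∘ₗ q ∘ₗ b) ∘ₗ i = a := by
    ext x
    have h2 : b (i x) = i (a x) := (congr_fun (congr_arg DFunLike.coe hab) x).symm
    have h3 : r (i (a x)) = a x := congr_fun (congr_arg DFunLike.coe hr) _
    simp [h2, h3, hiq.apply_apply_eq_zero]
  have h2 : (q ∘ₗ b) ∘ₗ s = c := by
    rw [hbc, comp_assoc, hs, comp_id]
  rw [← h1, ← h2, trace_comp_comm', ← trace_comp_comm' (q ∘ₗ b) s, ← map_add, ← hid]

/-- The trace of an endomorphism on an invariant subspace. -/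
noncomputable def LinearMap.traceOn {K V : Type*} [Field K] [AddCommGroup V] [Module K V]
    (T : V →ₗ[K] V) (W : Submodule K V) : K :=
  if h : ∀ x ∈ W, T x ∈ W then trace K W (T.restrict h) else 0

section
variable {K V : Type*} [Field K] [AddCommGroup V] [Module K V] {T : V →ₗ[K] V}

lemma LinearMap.traceOn_eq {W : Submodule K V} (h : ∀ x ∈ W, T x ∈ W) :
    T.traceOn W = trace K W (T.restrict h) := dif_pos h

lemma LinearMap.traceOn_bot : T.traceOn ⊥ = 0 := by
  unfold traceOn
  split_ifs
  · rw [Subsingleton.elim (T.restrict _) 0, map_zero]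
  · rfl

lemma LinearMap.traceOn_sup_add_inf {W₁ W₂ : Submodule K V} [FiniteDimensional K W₁]
    [FiniteDimensional K W₂] (h₁ : ∀ x ∈ W₁, T x ∈ W₁) (h₂ : ∀ x ∈ W₂, T x ∈ W₂) :
    T.traceOn (W₁ ⊔ W₂) + T.traceOn (W₁ ⊓ W₂) = T.traceOn W₁ + T.traceOn W₂ := by
  have hs : ∀ x ∈ W₁ ⊔ W₂, T x ∈ W₁ ⊔ W₂ := by
    intro x hx
    obtain ⟨y, hy, z, hz, rfl⟩ := Submodule.mem_sup.1 hx
    rw [map_add]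
    exact Submodule.add_mem_sup (h₁ y hy) (h₂ z hz)
  have hi : ∀ x ∈ W₁ ⊓ W₂, T x ∈ W₁ ⊓ W₂ := fun x hx => ⟨h₁ x hx.1, h₂ x hx.2⟩
  rw [traceOn_eq h₁, traceOn_eq h₂, traceOn_eq hs, traceOn_eq hi,
    ← trace_prodMap' (T.restrict h₁), add_comm (trace K ↥(W₁ ⊔ W₂) _)]
  refine (trace_eq_add_of_exact
    (A := ↥(W₁ ⊓ W₂)) (B := W₁ × W₂) (C := ↥(W₁ ⊔ W₂))
    (i := (Submodule.inclusion inf_le_left).prod (-(Submodule.inclusion inf_le_right)))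
    (q := (Submodule.inclusion le_sup_left).coprod (Submodule.inclusion le_sup_right))
    ?_ ?_ ?_ ?_ ?_).symm
  · intro x y hxy
    exact Submodule.inclusion_injective inf_le_left (congr_arg Prod.fst hxy)
  · rintro ⟨x, hx⟩
    obtain ⟨y, hy, z, hz, rfl⟩ := Submodule.mem_sup.1 hx
    exact ⟨(⟨y, hy⟩, ⟨z, hz⟩), rfl⟩
  · rintro ⟨⟨y, hy⟩, ⟨z, hz⟩⟩
    constructor
    · intro h
      have h' : y + z = 0 := congr_arg Subtype.val h
      obtain rfl := eq_neg_of_add_eq_zero_right h'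
      exact ⟨⟨y, hy, by simpa using hz⟩, rfl⟩
    · rintro ⟨⟨x, hx⟩, h⟩
      simp only [Prod.ext_iff, Subtype.ext_iff] at h
      have hy' : x = y := h.1
      have hz' : -x = z := h.2
      subst hy' hz'
      ext
      exact add_neg_cancel x
  · ext x <;> simp
  · ext x <;> simp

/-- Transport of the trace along an injective semi-equivariant map. -/
lemma LinearMap.traceOn_map {V' : Type*} [AddCommGroup V'] [Module K V'] {T' : V' →ₗ[K] V'}
    {W : Submodule K V} {L : V →ₗ[K] V'} {χ : K}
    (hL : Function.Injective L) (h : ∀ x ∈ W, T x ∈ W) (hχ : ∀ x, T' (L x) = χ • L (T x)) :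
    T'.traceOn (W.map L) = χ * T.traceOn W := by
  have h' : ∀ x ∈ W.map L, T' x ∈ W.map L := by
    rintro _ ⟨x, hx, rfl⟩
    rw [hχ]
    exact Submodule.smul_mem _ _ ⟨_, h x hx, rfl⟩
  rw [traceOn_eq h, traceOn_eq h', ← smul_eq_mul, ← map_smul,
    ← trace_conj' _ (Submodule.equivMapOfInjective L hL W)]
  congr 1
  ext x
  obtain ⟨x, rfl⟩ := (Submodule.equivMapOfInjective L hL W).surjective x
  simp [LinearEquiv.conj_apply, hχ]

end

namespace MvPolynomial

section DiagonalAction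
variable {σ K : Type*} [Field K]

/-- The endomorphism `p(x) ↦ p(μ x)` of the polynomial ring induced by `diag(μ)`. -/
noncomputable def diagonalHom (μ : σ → K) : MvPolynomial σ K →ₐ[K] MvPolynomial σ K :=
  aeval fun i => C (μ i) * X i

lemma diagonalHom_monomial (μ : σ → K) (m : σ →₀ ℕ) (c : K) :
    diagonalHom μ (monomial m c) = monomial m ((m.prod fun i k => μ i ^ k) * c) := by
  rw [diagonalHom, aeval_monomial, monomial_eq, algebraMap_eq]
  simp only [mul_pow, C_mul, Finsupp.prod, map_prod, C_pow, Finset.prod_mul_distrib]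
  ring

lemma coeff_diagonalHom (μ : σ → K) (m : σ →₀ ℕ) (p : MvPolynomial σ K) :
    coeff m (diagonalHom μ p) = (m.prod fun i k => μ i ^ k) * coeff m p := by
  induction p using MvPolynomial.induction_on' with
  | monomial u a =>
    rw [diagonalHom_monomial, coeff_monomial, coeff_monomial]
    split_ifs with h
    · rw [h]
    · rw [mul_zero]
  | add p q hp hq => rw [map_add, coeff_add, coeff_add, hp, hq, mul_add]

variable {w : σ → ℕ}

lemma weightedHomogeneousComponent_mul_of_isWeightedHomogeneous {h : MvPolynomial σ K} {e : ℕ}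
    (hh : IsWeightedHomogeneous w h e) (r : MvPolynomial σ K) (d : ℕ) :
    weightedHomogeneousComponent w d (h * r) =
      if e ≤ d then h * weightedHomogeneousComponent w (d - e) r else 0 := by
  induction r using MvPolynomial.induction_on' with
  | monomial u a =>
    have hu := isWeightedHomogeneous_monomial w u a rfl
    rw [weightedHomogeneousComponent_of_mem (hh.mul hu), weightedHomogeneousComponent_of_mem hu]
    split_ifs with h1 h2 h3 h4 h5
    · rfl
    · omega
    · omega
    · omega
    · exact (mul_zero h).symm
    · rfl
  | add p q hp hq =>
    rw [mul_add, map_add, map_add, hp, hq]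
    split_ifs <;> simp [mul_add]

lemma diagonalHom_mem_weightedHomogeneousSubmodule (μ : σ → K) {d : ℕ} {p : MvPolynomial σ K}
    (hp : p ∈ weightedHomogeneousSubmodule K w d) :
    diagonalHom μ p ∈ weightedHomogeneousSubmodule K w d := by
  intro m hm
  rw [coeff_diagonalHom] at hm
  exact hp (right_ne_zero_of_mul hm)

/-- An ideal is homogeneous for the weights `w` and stable under `diag(μ)`. -/
structure IsStableIdeal (w : σ → ℕ) (μ : σ → K) (I : Ideal (MvPolynomial σ K)) : Prop where
  component_mem : ∀ p ∈ I, ∀ d, weightedHomogeneousComponent w d p ∈ I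
  diagonalHom_mem : ∀ p ∈ I, diagonalHom μ p ∈ I

/-- The degree `d` part of an ideal. -/
noncomputable def gradedPart (w : σ → ℕ) (I : Ideal (MvPolynomial σ K)) (d : ℕ) :
    Submodule K (MvPolynomial σ K) :=
  I.restrictScalars K ⊓ weightedHomogeneousSubmodule K w d

lemma mem_gradedPart {I : Ideal (MvPolynomial σ K)} {d : ℕ} {p : MvPolynomial σ K} :
    p ∈ gradedPart w I d ↔ p ∈ I ∧ IsWeightedHomogeneous w p d := Iff.rfl

/-- The equivariant Hilbert series of the quotient by an ideal. -/
noncomputable def traceSeries (w : σ → ℕ) (μ : σ → K) (I : Ideal (MvPolynomial σ K)) :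
    PowerSeries K :=
  PowerSeries.mk fun d => (diagonalHom μ).toLinearMap.traceOn (gradedPart w ⊤ d) -
    (diagonalHom μ).toLinearMap.traceOn (gradedPart w I d)

lemma IsStableIdeal.mem_gradedPart {μ : σ → K} {I : Ideal (MvPolynomial σ K)}
    (hI : IsStableIdeal w μ I) (d : ℕ) :
    ∀ p ∈ gradedPart w I d, (diagonalHom μ).toLinearMap p ∈ gradedPart w I d :=
  fun p hp => ⟨hI.diagonalHom_mem p hp.1, diagonalHom_mem_weightedHomogeneousSubmodule μ hp.2⟩

lemma isStableIdeal_top (μ : σ → K) : IsStableIdeal w μ ⊤ := ⟨by simp, by simp⟩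

lemma isStableIdeal_bot (μ : σ → K) : IsStableIdeal w μ ⊥ := ⟨by simp, by simp⟩

lemma IsStableIdeal.sup_span {μ : σ → K} {I : Ideal (MvPolynomial σ K)}
    (hI : IsStableIdeal w μ I) {h : MvPolynomial σ K} {e : ℕ} {χ : K}
    (hh : IsWeightedHomogeneous w h e) (hχ : diagonalHom μ h = C χ * h) :
    IsStableIdeal w μ (I ⊔ Ideal.span {h}) := by
  constructor
  · intro p hp d
    obtain ⟨a, ha, r, hr, rfl⟩ := Submodule.mem_sup.1 hp
    obtain ⟨r, rfl⟩ := Ideal.mem_span_singleton.1 hr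
    rw [map_add, weightedHomogeneousComponent_mul_of_isWeightedHomogeneous hh]
    refine Submodule.add_mem_sup (hI.component_mem a ha d) ?_
    split_ifs
    · exact Ideal.mul_mem_right _ _ (Ideal.mem_span_singleton_self h)
    · exact zero_mem _
  · intro p hp
    obtain ⟨a, ha, r, hr, rfl⟩ := Submodule.mem_sup.1 hp
    obtain ⟨r, rfl⟩ := Ideal.mem_span_singleton.1 hr
    rw [map_add, map_mul, hχ]
    exact Submodule.add_mem_sup (hI.diagonalHom_mem a ha) (Ideal.mul_mem_right _ _
      (Ideal.mul_mem_left _ _ (Ideal.mem_span_singleton_self h)))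

lemma finiteDimensional_gradedPart [Finite σ] (hw : ∀ i, w i ≠ 0) (I : Ideal (MvPolynomial σ K))
    (d : ℕ) : FiniteDimensional K (gradedPart w I d) := by
  have : FiniteDimensional K (weightedHomogeneousSubmodule K w d) :=
    Module.Finite.iff_fg.2 (weightedHomogeneousSubmodule_fg K w hw d)
  exact Submodule.finiteDimensional_of_le (S₂ := weightedHomogeneousSubmodule K w d) inf_le_right

lemma traceSeries_sup_span [Finite σ] (hw : ∀ i, w i ≠ 0) {μ : σ → K}
    {I : Ideal (MvPolynomial σ K)} (hI : IsStableIdeal w μ I) {h : MvPolynomial σ K} {e : ℕ}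
    {χ : K} (h0 : h ≠ 0) (hh : IsWeightedHomogeneous w h e) (hχ : diagonalHom μ h = C χ * h)
    (hreg : ∀ y d, IsWeightedHomogeneous w y d → h * y ∈ I → y ∈ I) :
    traceSeries w μ (I ⊔ Ideal.span {h}) =
      traceSeries w μ I * (1 - PowerSeries.C χ * PowerSeries.X ^ e) := by
  have := finiteDimensional_gradedPart (K := K) hw
  have hL : Function.Injective (LinearMap.mulLeft K h) := by
    intro x y hxy
    exact mul_left_cancel₀ h0 hxy
  have hTL (x : MvPolynomial σ K) : (diagonalHom μ).toLinearMap (LinearMap.mulLeft K h x) =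
      χ • LinearMap.mulLeft K h ((diagonalHom μ).toLinearMap x) := by
    simp [hχ, smul_eq_C_mul, mul_assoc]
  ext d
  rw [mul_sub, mul_one, map_sub, ← mul_assoc, PowerSeries.coeff_mul_X_pow',
    mul_comm (traceSeries _ _ _), traceSeries, traceSeries]
  simp only [PowerSeries.coeff_C_mul, PowerSeries.coeff_mk]
  split_ifs with hed
  · have hsup : gradedPart w (I ⊔ Ideal.span {h}) d =
        gradedPart w I d ⊔ (gradedPart w ⊤ (d - e)).map (LinearMap.mulLeft K h) := by
      apply le_antisymm
      · rintro p ⟨hp, hpd⟩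
        obtain ⟨a, ha, r, hr, hp⟩ := Submodule.mem_sup.1 hp
        obtain ⟨r, rfl⟩ := Ideal.mem_span_singleton.1 hr
        rw [← weightedHomogeneousComponent_eq_self hpd, ← hp, map_add,
          weightedHomogeneousComponent_mul_of_isWeightedHomogeneous hh, if_pos hed]
        exact Submodule.add_mem_sup ⟨hI.component_mem a ha d,
          weightedHomogeneousComponent_mem _ _ _⟩ ⟨_, ⟨trivial,
            weightedHomogeneousComponent_mem _ _ _⟩, rfl⟩
      · refine sup_le (inf_le_inf_right _ (Submodule.restrictScalars_mono K le_sup_left)) ?_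
        rintro _ ⟨y, hy, rfl⟩
        refine ⟨Ideal.mem_sup_right (Ideal.mul_mem_right _ _ (Ideal.mem_span_singleton_self h)), ?_⟩
        have := hh.mul hy.2
        rwa [Nat.add_sub_cancel' hed] at this
    have hinf : gradedPart w I d ⊓ (gradedPart w ⊤ (d - e)).map (LinearMap.mulLeft K h) =
        (gradedPart w I (d - e)).map (LinearMap.mulLeft K h) := by
      apply le_antisymm
      · rintro _ ⟨hp, y, hy, rfl⟩
        exact ⟨y, ⟨hreg y _ hy.2 hp.1, hy.2⟩, rfl⟩
      · rintro _ ⟨y, hy, rfl⟩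
        refine ⟨⟨Ideal.mul_mem_left _ _ hy.1, ?_⟩, ⟨y, ⟨trivial, hy.2⟩, rfl⟩⟩
        have := hh.mul hy.2
        rwa [Nat.add_sub_cancel' hed] at this
    have hmap : ∀ x ∈ (gradedPart w ⊤ (d - e)).map (LinearMap.mulLeft K h),
        (diagonalHom μ).toLinearMap x ∈ (gradedPart w ⊤ (d - e)).map (LinearMap.mulLeft K h) := by
      rintro _ ⟨y, hy, rfl⟩
      rw [hTL]
      exact Submodule.smul_mem _ _ ⟨_, (isStableIdeal_top μ).mem_gradedPart _ y hy, rfl⟩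
    have key := LinearMap.traceOn_sup_add_inf (hI.mem_gradedPart d) hmap
    rw [← hsup, hinf, LinearMap.traceOn_map hL (hI.mem_gradedPart _) hTL,
      LinearMap.traceOn_map hL ((isStableIdeal_top μ).mem_gradedPart _) hTL] at key
    linear_combination -key
  · have hsup : gradedPart w (I ⊔ Ideal.span {h}) d = gradedPart w I d := by
      apply le_antisymm
      · rintro p ⟨hp, hpd⟩
        obtain ⟨a, ha, r, hr, hp⟩ := Submodule.mem_sup.1 hp
        obtain ⟨r, rfl⟩ := Ideal.mem_span_singleton.1 hr
        rw [← weightedHomogeneousComponent_eq_self hpd, ← hp, map_add,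
          weightedHomogeneousComponent_mul_of_isWeightedHomogeneous hh, if_neg hed, add_zero]
        exact ⟨hI.component_mem a ha d, weightedHomogeneousComponent_mem _ _ _⟩
      · exact inf_le_inf_right _ (Submodule.restrictScalars_mono K le_sup_left)
    rw [hsup, sub_zero]

/-- The equivariant Hilbert series of a homogeneous complete intersection. -/
theorem traceSeries_span_range [Finite σ] (hw : ∀ i, w i ≠ 0) {μ : σ → K} {r : ℕ}
    {h : Fin r → MvPolynomial σ K} {e : Fin r → ℕ} {χ : Fin r → K} (h0 : ∀ i, h i ≠ 0)
    (hh : ∀ i, IsWeightedHomogeneous w (h i) (e i)) (hχ : ∀ i, diagonalHom μ (h i) = C (χ i) * h i)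
    (hreg : ∀ i y d, IsWeightedHomogeneous w y d → h i * y ∈ Ideal.span (h '' Set.Iio i) →
      y ∈ Ideal.span (h '' Set.Iio i)) :
    IsStableIdeal w μ (Ideal.span (Set.range h)) ∧ traceSeries w μ (Ideal.span (Set.range h)) =
      traceSeries w μ ⊥ * ∏ i, (1 - PowerSeries.C (χ i) * PowerSeries.X ^ e i) := by
  induction r with
  | zero => simp [Set.range_eq_empty, isStableIdeal_bot]
  | succ r ih =>
    have hIio (i : Fin r) : h '' Set.Iio i.castSucc = (h ∘ Fin.castSucc) '' Set.Iio i := by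
      rw [Set.image_comp]
      congr 1
      ext j
      simp only [Set.mem_Iio, Set.mem_image]
      exact ⟨fun hj => ⟨⟨j, by have : j.val < i.val := hj; omega⟩, hj, rfl⟩,
        by rintro ⟨k, hk, rfl⟩; exact hk⟩
    have hlast : h '' Set.Iio (Fin.last r) = Set.range (h ∘ Fin.castSucc) := by
      rw [Set.range_comp]
      congr 1
      ext j
      simp only [Set.mem_Iio, Set.mem_range]
      exact ⟨fun hj => ⟨⟨j, hj⟩, rfl⟩, by rintro ⟨k, rfl⟩; exact k.castSucc_lt_last⟩
    have hrange : Ideal.span (Set.range h) =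
        Ideal.span (Set.range (h ∘ Fin.castSucc)) ⊔ Ideal.span {h (Fin.last r)} := by
      rw [← Ideal.span_union]
      congr 1
      ext p
      simp only [Set.mem_range, Fin.exists_fin_succ', Set.mem_union, Set.mem_singleton_iff,
        Function.comp, eq_comm]
    obtain ⟨h1, h2⟩ := ih (h := h ∘ Fin.castSucc) (e := e ∘ Fin.castSucc) (χ := χ ∘ Fin.castSucc)
      (fun i => h0 _) (fun i => hh _) (fun i => hχ _) (fun i => by
        rw [← hIio]; exact hreg i.castSucc)
    rw [hrange]
    refine ⟨h1.sup_span (hh _) (hχ _), ?_⟩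
    rw [traceSeries_sup_span hw h1 (h0 _) (hh _) (hχ _) (by rw [← hlast]; exact hreg _), h2,
      Fin.prod_univ_castSucc, mul_assoc]
    rfl

end DiagonalAction
end MvPolynomial

open RingTheory.Sequence in
lemma RingTheory.Sequence.isWeaklyRegular_ofFn_iff {R : Type*} [CommRing R] {r : ℕ}
    (h : Fin r → R) : IsWeaklyRegular R (List.ofFn h) ↔
      ∀ i y, h i * y ∈ Ideal.span (h '' Set.Iio i) → y ∈ Ideal.span (h '' Set.Iio i) := by
  have htake (i : ℕ) (hi : i < r) :
      Ideal.ofList ((List.ofFn h).take i) = Ideal.span (h '' Set.Iio ⟨i, hi⟩) := by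
    rw [Ideal.ofList]
    congr 1
    ext x
    simp only [Set.mem_ofPred_eq, List.mem_take_iff_getElem, List.getElem_ofFn, List.length_ofFn,
      Set.mem_image, Set.mem_Iio, Fin.lt_def]
    exact ⟨fun ⟨j, hj, hx⟩ => ⟨⟨j, by omega⟩, show j < i by omega, hx⟩,
      fun ⟨j, hj, hx⟩ => ⟨j, by have := j.isLt; omega, hx⟩⟩
  rw [isWeaklyRegular_iff]
  constructor
  · intro H ⟨i, hi⟩ y hy
    have := isSMulRegular_iff_right_eq_zero_of_smul.1 (H i (by simpa using hi))
      (Submodule.Quotient.mk y)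
    rw [← Submodule.Quotient.mk_smul, Submodule.Quotient.mk_eq_zero,
      Submodule.Quotient.mk_eq_zero, htake i hi, List.getElem_ofFn] at this
    simpa using this (by simpa using hy)
  · intro H i hi
    have hi' : i < r := by simpa using hi
    refine isSMulRegular_iff_right_eq_zero_of_smul.2 fun m => ?_
    obtain ⟨y, rfl⟩ := Submodule.Quotient.mk_surjective _ m
    rw [← Submodule.Quotient.mk_smul, Submodule.Quotient.mk_eq_zero,
      Submodule.Quotient.mk_eq_zero, htake i hi', List.getElem_ofFn]
    intro hy
    simpa using H ⟨i, hi'⟩ y (by simpa using hy)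

namespace MvPolynomial

section RegularSequence
variable {K : Type*} [Field K] {n : ℕ}

lemma X_mul_mem_span_X_image {σ R : Type*} [CommRing R] {s : Set σ} {i : σ} (hi : i ∉ s)
    {y : MvPolynomial σ R} (hy : X i * y ∈ Ideal.span (X '' s)) : y ∈ Ideal.span (X '' s) := by
  rw [mem_ideal_span_X_image] at hy ⊢
  intro m hm
  obtain ⟨j, hj, hmj⟩ := hy (Finsupp.single i 1 + m) (by
    rw [mem_support_iff, coeff_X_mul]; exact mem_support_iff.1 hm)
  refine ⟨j, hj, ?_⟩
  have hij : i ≠ j := fun h => hi (h ▸ hj)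
  simpa [Finsupp.single_apply, hij] using hmj

lemma ker_constantCoeff_eq_span_X {σ R : Type*} [CommRing R] :
    RingHom.ker (constantCoeff (σ := σ) (R := R)) = Ideal.span (Set.range X) := by
  rw [← Set.image_univ]
  ext p
  rw [mem_ideal_span_X_image, RingHom.mem_ker, constantCoeff_eq]
  constructor
  · intro hp m hm
    by_contra! h
    have : m = 0 := by ext i; simpa using h i
    exact mem_support_iff.1 hm (this ▸ hp)
  · intro h
    by_contra hp
    obtain ⟨i, -, hi⟩ := h 0 (mem_support_iff.2 hp)
    exact hi rfl

lemma weightedHomogeneousComponent_mem_span {σ : Type*} {w : σ → ℕ} {s : Set (MvPolynomial σ K)}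
    (hs : ∀ p ∈ s, ∃ e, IsWeightedHomogeneous w p e) {p : MvPolynomial σ K}
    (hp : p ∈ Ideal.span s) (d : ℕ) : weightedHomogeneousComponent w d p ∈ Ideal.span s :=
  let := weightedGradedAlgebra K w
  weightedHomogeneousComponent_mem_of_mem K w (Ideal.homogeneous_span _ _ hs) hp d

/-- Homogeneous polynomials of positive degree, as many as there are variables, with
zero-dimensional quotient form a regular sequence. -/
theorem regular_of_pow_mem {w : Fin n → ℕ} (hw : ∀ i, w i ≠ 0)
    {h : Fin n → MvPolynomial (Fin n) K} {e : Fin n → ℕ}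
    (hh : ∀ i, IsWeightedHomogeneous w (h i) (e i)) (hc : ∀ i, constantCoeff (h i) = 0)
    (hpow : ∀ i, ∃ k : ℕ, (X i : MvPolynomial (Fin n) K) ^ k ∈ Ideal.span (Set.range h))
    (i : Fin n) (y : MvPolynomial (Fin n) K) (d : ℕ) (hyd : IsWeightedHomogeneous w y d)
    (hy : h i * y ∈ Ideal.span (h '' Set.Iio i)) : y ∈ Ideal.span (h '' Set.Iio i) := by
  let P := MvPolynomial (Fin n) K
  let 𝔪 : Ideal P := RingHom.ker (constantCoeff (σ := Fin n) (R := K))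
  have : 𝔪.IsPrime := RingHom.ker_isPrime _
  let S := Localization.AtPrime 𝔪
  have hspan : IsLocalRing.maximalIdeal S =
      Ideal.span (Set.range fun i => algebraMap P S (X i)) := by
    rw [← IsLocalization.AtPrime.map_eq_maximalIdeal 𝔪 S]
    change Ideal.map _ (RingHom.ker _) = _
    rw [ker_constantCoeff_eq_span_X, Ideal.map_span, ← Set.range_comp]
    rfl
  have hofList (u : Fin n → S) : Ideal.ofList (List.ofFn u) = Ideal.span (Set.range u) := by
    rw [Ideal.ofList]
    congr 1
    ext x
    simp [List.mem_ofFn]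
  have hX : RingTheory.Sequence.IsWeaklyRegular S (List.ofFn fun i => algebraMap P S (X i)) := by
    have := RingTheory.Sequence.IsWeaklyRegular.of_isLocalization S 𝔪.primeCompl
      ((RingTheory.Sequence.isWeaklyRegular_ofFn_iff (X : Fin n → P)).2 fun i y hy =>
        X_mul_mem_span_X_image (by simp) hy)
    rwa [List.map_ofFn] at this
  have hmem (p : P) (hp : constantCoeff p = 0) : algebraMap P S p ∈ IsLocalRing.maximalIdeal S :=
    (IsLocalization.AtPrime.to_map_mem_maximal_iff S 𝔪 p).2 hp
  have hreg : RingTheory.Sequence.IsWeaklyRegular S (List.ofFn fun i => algebraMap P S (h i)) := by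
    refine RingTheory.Sequence.IsWeaklyRegular.of_length_eq_of_maximalIdeal_le_radical
      (by simp) ?_ ?_ ?_ ?_ hX
    · intro x hx
      obtain ⟨i, rfl⟩ := (List.mem_ofFn' _ _).1 hx
      exact hmem _ (by simp)
    · intro x hx
      obtain ⟨i, rfl⟩ := (List.mem_ofFn' _ _).1 hx
      exact hmem _ (hc i)
    · rw [hofList, ← hspan]
      exact le_sup_left.trans Ideal.le_radical
    · rw [hofList]
      conv_lhs => rw [hspan]
      rw [Ideal.span_le]
      rintro _ ⟨j, rfl⟩
      obtain ⟨k, hk⟩ := hpow j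
      refine ⟨k, Ideal.mem_sup_left ?_⟩
      simp only [← map_pow]
      have := Ideal.mem_map_of_mem (algebraMap P S) hk
      rw [Ideal.map_span, ← Set.range_comp] at this
      exact this
  have hIio : Ideal.span ((fun i => algebraMap P S (h i)) '' Set.Iio i) =
      (Ideal.span (h '' Set.Iio i)).map (algebraMap P S) := by
    rw [Ideal.map_span, Set.image_image]
  have key := (RingTheory.Sequence.isWeaklyRegular_ofFn_iff _).1 hreg i (algebraMap P S y) (by
    rw [hIio, ← map_mul]
    exact Ideal.mem_map_of_mem _ hy)
  rw [hIio, IsLocalization.algebraMap_mem_map_algebraMap_iff 𝔪.primeCompl S] at key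
  obtain ⟨s, hs, hsy⟩ := key
  have hs0 : coeff 0 s ≠ 0 := hs
  have hcomp := weightedHomogeneousComponent_mem_span
    (by rintro _ ⟨j, -, rfl⟩; exact ⟨e j, hh j⟩) hsy d
  rw [mul_comm, weightedHomogeneousComponent_mul_of_isWeightedHomogeneous hyd, if_pos le_rfl,
    Nat.sub_self, weightedHomogeneousComponent_zero _ hw] at hcomp
  have := Ideal.mul_mem_right (C (coeff 0 s)⁻¹) _ hcomp
  rwa [mul_assoc, ← C_mul, mul_inv_cancel₀ hs0, C_1, mul_one] at this

end RegularSequence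
end MvPolynomial

namespace MvPolynomial

section TraceSeries
variable {σ K : Type*} [Field K] {w : σ → ℕ} {μ : σ → K}

lemma traceSeries_ker_constantCoeff (hw : ∀ i, w i ≠ 0) :
    traceSeries w μ (RingHom.ker constantCoeff) = 1 := by
  ext d
  rw [traceSeries, PowerSeries.coeff_mk, PowerSeries.coeff_one]
  split_ifs with hd
  · subst hd
    have hC (p : MvPolynomial σ K) (hp : IsWeightedHomogeneous w p 0) : p = C (coeff 0 p) := by
      rw [← weightedHomogeneousComponent_zero p hw, weightedHomogeneousComponent_eq_self hp]
    have hbot : gradedPart w (RingHom.ker (constantCoeff (σ := σ) (R := K))) 0 = ⊥ := by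
      refine (Submodule.eq_bot_iff _).2 fun p hp => ?_
      have h0 : coeff 0 p = 0 := hp.1
      rw [hC p hp.2, h0, C_0]
    have htop : gradedPart w (⊤ : Ideal (MvPolynomial σ K)) 0 = K ∙ (1 : MvPolynomial σ K) := by
      ext p
      rw [mem_gradedPart, Submodule.mem_span_singleton]
      constructor
      · rintro ⟨-, hp⟩
        exact ⟨coeff 0 p, by rw [smul_eq_C_mul, mul_one, ← hC p hp]⟩
      · rintro ⟨a, rfl⟩
        rw [smul_eq_C_mul, mul_one]
        exact ⟨trivial, isWeightedHomogeneous_C _ _⟩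
    have : FiniteDimensional K (gradedPart w (⊤ : Ideal (MvPolynomial σ K)) 0) := by
      rw [htop]; infer_instance
    have hid : (diagonalHom μ).toLinearMap.restrict ((isStableIdeal_top μ).mem_gradedPart
        (w := w) 0) = LinearMap.id := by
      ext1 ⟨p, hp⟩
      refine Subtype.ext ?_
      change diagonalHom μ p = p
      rw [hC p hp.2]
      exact AlgHom.commutes _ _
    rw [hbot, LinearMap.traceOn_bot, sub_zero,
      LinearMap.traceOn_eq ((isStableIdeal_top μ).mem_gradedPart 0), hid, LinearMap.trace_id, htop,
      finrank_span_singleton one_ne_zero, Nat.cast_one]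
  · have : gradedPart w (RingHom.ker (constantCoeff (σ := σ) (R := K))) d = gradedPart w ⊤ d := by
      refine le_antisymm (inf_le_inf_right _ fun _ _ => trivial) fun p hp => ⟨?_, hp.2⟩
      change coeff 0 p = 0
      by_contra h0
      exact hd (by simpa using (hp.2 h0).symm)
    rw [this, sub_self]

/-- The part of an ideal consisting of polynomials of weighted degree less than `D`. -/
noncomputable def truncPart (w : σ → ℕ) (I : Ideal (MvPolynomial σ K)) (D : ℕ) :
    Submodule K (MvPolynomial σ K) :=
  I.restrictScalars K ⊓ restrictSupport K {m | Finsupp.weight w m < D}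

lemma mem_truncPart {I : Ideal (MvPolynomial σ K)} {D : ℕ} {p : MvPolynomial σ K} :
    p ∈ truncPart w I D ↔ p ∈ I ∧ ∀ m, coeff m p ≠ 0 → Finsupp.weight w m < D := by
  simp [truncPart, mem_restrictSupport_iff, Set.subset_def]

lemma IsStableIdeal.mem_truncPart {I : Ideal (MvPolynomial σ K)} (hI : IsStableIdeal w μ I)
    (D : ℕ) : ∀ p ∈ truncPart w I D, (diagonalHom μ).toLinearMap p ∈ truncPart w I D := by
  intro p hp
  rw [MvPolynomial.mem_truncPart] at hp ⊢
  refine ⟨hI.diagonalHom_mem p hp.1, fun m hm => hp.2 m ?_⟩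
  rw [AlgHom.toLinearMap_apply, coeff_diagonalHom] at hm
  exact right_ne_zero_of_mul hm

lemma truncPart_zero (I : Ideal (MvPolynomial σ K)) : truncPart w I 0 = ⊥ := by
  refine (Submodule.eq_bot_iff _).2 fun p hp => ?_
  ext m
  by_contra hm
  exact absurd ((mem_truncPart.1 hp).2 m hm) (Nat.not_lt_zero _)

lemma IsStableIdeal.truncPart_succ {I : Ideal (MvPolynomial σ K)} (hI : IsStableIdeal w μ I)
    (D : ℕ) : truncPart w I (D + 1) = truncPart w I D ⊔ gradedPart w I D := by
  apply le_antisymm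
  · intro p hp
    rw [MvPolynomial.mem_truncPart] at hp
    rw [← sub_add_cancel p (weightedHomogeneousComponent w D p)]
    have hD := hI.component_mem p hp.1 D
    refine Submodule.add_mem_sup (MvPolynomial.mem_truncPart.2 ⟨sub_mem hp.1 hD, fun m hm => ?_⟩)
      ⟨hD, weightedHomogeneousComponent_mem _ _ _⟩
    rw [coeff_sub, coeff_weightedHomogeneousComponent] at hm
    split_ifs at hm with h
    · simp at hm
    · have := hp.2 m (by simpa using hm)
      omega
  · refine sup_le ?_ ?_
    · intro p hp
      rw [MvPolynomial.mem_truncPart] at hp ⊢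
      exact ⟨hp.1, fun m hm => (hp.2 m hm).trans (Nat.lt_succ_self D)⟩
    · intro p hp
      exact MvPolynomial.mem_truncPart.2 ⟨hp.1, fun m hm => by rw [hp.2 hm]; exact D.lt_succ_self⟩

lemma truncPart_inf_gradedPart (I : Ideal (MvPolynomial σ K)) (D : ℕ) :
    truncPart w I D ⊓ gradedPart w I D = ⊥ := by
  refine (Submodule.eq_bot_iff _).2 fun p hp => ?_
  ext m
  by_contra hm
  exact absurd (hp.2.2 hm) ((mem_truncPart.1 hp.1).2 m hm).ne

lemma IsStableIdeal.traceOn_truncPart [Finite σ] (hw : ∀ i, w i ≠ 0)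
    {I : Ideal (MvPolynomial σ K)} (hI : IsStableIdeal w μ I) (D : ℕ) :
    FiniteDimensional K (truncPart w I D) ∧
      (diagonalHom μ).toLinearMap.traceOn (truncPart w I D) =
        ∑ d ∈ Finset.range D, (diagonalHom μ).toLinearMap.traceOn (gradedPart w I d) := by
  induction D with
  | zero =>
    rw [truncPart_zero, LinearMap.traceOn_bot]
    exact ⟨inferInstance, by simp⟩
  | succ D ih =>
    have := ih.1
    have := finiteDimensional_gradedPart hw I D
    rw [hI.truncPart_succ, Finset.sum_range_succ, ← ih.2,
      ← LinearMap.traceOn_sup_add_inf (hI.mem_truncPart D) (hI.mem_gradedPart D),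
      truncPart_inf_gradedPart, LinearMap.traceOn_bot, add_zero]
    exact ⟨inferInstance, rfl⟩

lemma exists_mem_truncPart_sub_mem {J : Ideal (MvPolynomial σ K)} {D : ℕ}
    (hD : ∀ m, D ≤ Finsupp.weight w m → monomial m 1 ∈ J) (p : MvPolynomial σ K) :
    ∃ q ∈ truncPart w ⊤ D, q - p ∈ J := by
  induction p using MvPolynomial.induction_on' with
  | monomial u a =>
    by_cases hu : D ≤ Finsupp.weight w u
    · refine ⟨0, zero_mem _, ?_⟩
      rw [zero_sub, neg_mem_iff, ← mul_one a, ← C_mul_monomial]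
      exact Ideal.mul_mem_left _ _ (hD u hu)
    · refine ⟨monomial u a, mem_truncPart.2 ⟨trivial, fun m hm => ?_⟩, by simp⟩
      rw [coeff_monomial] at hm
      obtain ⟨rfl, -⟩ := ite_ne_right_iff.1 hm
      exact not_le.1 hu
  | add p q hp hq =>
    obtain ⟨p', hp', hp⟩ := hp
    obtain ⟨q', hq', hq⟩ := hq
    exact ⟨p' + q', add_mem hp' hq', by rw [add_sub_add_comm]; exact add_mem hp hq⟩

/-- On a finite-dimensional quotient the trace is the value at `1` of the equivariant Hilbert
series, which is then a polynomial. -/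
theorem trace_quotient_eq_eval_traceSeries [Finite σ] (hw : ∀ i, w i ≠ 0)
    {J : Ideal (MvPolynomial σ K)} (hJ : IsStableIdeal w μ J)
    [FiniteDimensional K (MvPolynomial σ K ⧸ J)] {D : ℕ}
    (hD : ∀ m, D ≤ Finsupp.weight w m → monomial m 1 ∈ J)
    {φ : (MvPolynomial σ K ⧸ J) →ₗ[K] (MvPolynomial σ K ⧸ J)}
    (hφ : ∀ x, φ (Ideal.Quotient.mk J x) = Ideal.Quotient.mk J (diagonalHom μ x)) :
    ∃ p : Polynomial K, (p : PowerSeries K) = traceSeries w μ J ∧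
      p.eval 1 = LinearMap.trace K _ φ := by
  refine ⟨(traceSeries w μ J).trunc D, ?_, ?_⟩
  · ext d
    rw [Polynomial.coeff_coe, PowerSeries.coeff_trunc]
    split_ifs with hd
    · rfl
    · have : gradedPart w J d = gradedPart w ⊤ d := by
        refine le_antisymm (inf_le_inf_right _ fun _ _ => trivial) fun p hp => ⟨?_, hp.2⟩
        change p ∈ J
        rw [← p.support_sum_monomial_coeff]
        refine sum_mem fun m hm => ?_
        rw [← mul_one (coeff m p), ← C_mul_monomial]
        refine Ideal.mul_mem_left _ _ (hD m ?_)
        rw [hp.2 (mem_support_iff.1 hm)]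
        exact not_lt.1 hd
      rw [traceSeries, PowerSeries.coeff_mk, this, sub_self]
  · rw [Polynomial.eval, PowerSeries.eval₂_trunc_eq_sum_range]
    simp only [traceSeries, PowerSeries.coeff_mk, RingHom.id_apply, one_pow, mul_one,
      Finset.sum_sub_distrib]
    obtain ⟨h1, h2⟩ := (isStableIdeal_top μ).traceOn_truncPart hw D
    obtain ⟨h3, h4⟩ := hJ.traceOn_truncPart hw D
    rw [← h2, ← h4, LinearMap.traceOn_eq ((isStableIdeal_top μ).mem_truncPart D),
      LinearMap.traceOn_eq (hJ.mem_truncPart D), sub_eq_iff_eq_add']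
    have hle : truncPart w J D ≤ truncPart w ⊤ D := inf_le_inf_right _ fun _ _ => trivial
    refine LinearMap.trace_eq_add_of_exact (i := Submodule.inclusion hle)
      (q := (Ideal.Quotient.mkₐ K J).toLinearMap ∘ₗ (truncPart w ⊤ D).subtype)
      (Submodule.inclusion_injective hle) ?_ ?_ ?_ ?_
    · intro y
      obtain ⟨x, rfl⟩ := Ideal.Quotient.mk_surjective y
      obtain ⟨q, hq, hqx⟩ := exists_mem_truncPart_sub_mem hD x
      exact ⟨⟨q, hq⟩, Ideal.Quotient.eq.2 hqx⟩
    · rintro ⟨x, hx⟩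
      constructor
      · intro h
        exact ⟨⟨x, Ideal.Quotient.eq_zero_iff_mem.1 h, hx.2⟩, rfl⟩
      · rintro ⟨⟨y, hy⟩, hyx⟩
        obtain rfl : y = x := congr_arg Subtype.val hyx
        exact Ideal.Quotient.eq_zero_iff_mem.2 hy.1
    · rfl
    · ext1 x
      exact (hφ x).symm

lemma exists_X_pow_mem (hw : ∀ i, w i ≠ 0) {J : Ideal (MvPolynomial σ K)}
    (hJ : ∀ p ∈ J, ∀ d, weightedHomogeneousComponent w d p ∈ J)
    [FiniteDimensional K (MvPolynomial σ K ⧸ J)] (i : σ) :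
    ∃ k : ℕ, (X i : MvPolynomial σ K) ^ k ∈ J := by
  have hint : IsIntegral K (Ideal.Quotient.mk J (X i)) := Algebra.IsIntegral.isIntegral _
  obtain ⟨g, hg, hg0⟩ := hint
  have hmem : Polynomial.aeval (X i : MvPolynomial σ K) g ∈ J := by
    rw [← Ideal.Quotient.eq_zero_iff_mem, ← hg0]
    exact (Polynomial.aeval_algHom_apply (Ideal.Quotient.mkₐ K J) (X i) g).symm
  have hX (j : ℕ) : (X i : MvPolynomial σ K) ^ j ∈ weightedHomogeneousSubmodule K w (j * w i) :=
    (isWeightedHomogeneous_X K w i).pow j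
  refine ⟨g.natDegree, ?_⟩
  have := hJ _ hmem (g.natDegree * w i)
  rwa [Polynomial.aeval_eq_sum_range, map_sum, Finset.sum_eq_single g.natDegree, map_smul,
    hg.coeff_natDegree, one_smul, weightedHomogeneousComponent_of_mem (hX _), if_pos rfl] at this
  · intro j _ hj
    rw [map_smul, weightedHomogeneousComponent_of_mem (hX j), if_neg, smul_zero]
    exact fun h => hj (Nat.eq_of_mul_eq_mul_right (Nat.pos_of_ne_zero (hw i)) h.symm)
  · simp

lemma exists_forall_monomial_mem [Fintype σ] {J : Ideal (MvPolynomial σ K)}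
    (hJ : ∀ i, ∃ k : ℕ, (X i : MvPolynomial σ K) ^ k ∈ J) :
    ∃ D, ∀ m, D ≤ Finsupp.weight w m → monomial m 1 ∈ J := by
  choose k hk using hJ
  refine ⟨∑ i, k i * w i + 1, fun m hm => ?_⟩
  obtain ⟨i, hi⟩ : ∃ i, k i ≤ m i := by
    by_contra! h
    rw [Finsupp.weight_apply, Finsupp.sum_fintype _ _ (by simp)] at hm
    have : ∑ i, m i • w i ≤ ∑ i, k i * w i :=
      Finset.sum_le_sum fun i _ => Nat.mul_le_mul_right _ (h i).le
    omega
  have hle : Finsupp.single i (k i) ≤ m := by simpa using hi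
  rw [← tsub_add_cancel_of_le hle, ← mul_one (1 : K), ← monomial_mul, ← X_pow_eq_monomial]
  exact Ideal.mul_mem_left _ _ (hk i)

end TraceSeries
end MvPolynomial

lemma Polynomial.eval_one_eq_prod_of_mul_eq {n N : ℕ} {Q : Fin n → ℕ} (hQpos : ∀ i, 0 < Q i)
    (hQlt : ∀ i, Q i < N) {K : Type*} [Field K] [CharZero K] {μ : Fin n → K} (hμ : ∀ i, μ i ≠ 0)
    {p : Polynomial K}
    (hp : p * ∏ i, (1 - Polynomial.C (μ i) * Polynomial.X ^ Q i) =
      ∏ i, (1 - Polynomial.C (μ i)⁻¹ * Polynomial.X ^ (N - Q i))) :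
    p.eval 1 = ∏ i, if μ i = 1 then (N : K) / Q i - 1 else -(μ i)⁻¹ := by
  let F (i : Fin n) : Polynomial K := if μ i = 1 then 1 - Polynomial.X else 1
  let A (i : Fin n) : Polynomial K := if μ i = 1 then ∑ j ∈ Finset.range (Q i), Polynomial.X ^ j
    else 1 - Polynomial.C (μ i) * Polynomial.X ^ Q i
  let B (i : Fin n) : Polynomial K := if μ i = 1 then
    ∑ j ∈ Finset.range (N - Q i), Polynomial.X ^ j
    else 1 - Polynomial.C (μ i)⁻¹ * Polynomial.X ^ (N - Q i)
  have hA (i) : 1 - Polynomial.C (μ i) * Polynomial.X ^ Q i = F i * A i := by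
    by_cases h : μ i = 1
    · simp only [F, A, if_pos h, mul_neg_geom_sum]
      simp [h]
    · simp only [F, A, if_neg h, one_mul]
  have hB (i) : 1 - Polynomial.C (μ i)⁻¹ * Polynomial.X ^ (N - Q i) = F i * B i := by
    by_cases h : μ i = 1
    · simp only [F, B, if_pos h, mul_neg_geom_sum]
      simp [h]
    · simp only [F, B, if_neg h, one_mul]
  have hF : ∏ i, F i ≠ 0 := by
    refine Finset.prod_ne_zero_iff.2 fun i _ => ?_
    simp only [F]
    split_ifs
    · intro h
      simpa using congr_arg (Polynomial.eval 0) h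
    · exact one_ne_zero
  simp only [hA, hB, Finset.prod_mul_distrib] at hp
  have hp' : p * ∏ i, A i = ∏ i, B i := mul_left_cancel₀ hF (by rw [← hp]; ring)
  have hev := congr_arg (Polynomial.eval 1) hp'
  rw [Polynomial.eval_mul, Polynomial.eval_prod, Polynomial.eval_prod] at hev
  have hQ (i) : (Q i : K) ≠ 0 := Nat.cast_ne_zero.2 (hQpos i).ne'
  have hA1 (i) : (A i).eval 1 = if μ i = 1 then (Q i : K) else 1 - μ i := by
    simp only [A]
    split_ifs <;> simp [Polynomial.eval_finsetSum]
  have hB1 (i) : (B i).eval 1 = if μ i = 1 then (N : K) - Q i else 1 - (μ i)⁻¹ := by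
    simp only [B]
    split_ifs <;> simp [Polynomial.eval_finsetSum, Nat.cast_sub (hQlt i).le]
  have hA0 (i) : (A i).eval 1 ≠ 0 := by
    rw [hA1]
    split_ifs with h
    · exact hQ i
    · exact sub_ne_zero.2 (Ne.symm h)
  refine mul_right_cancel₀ (Finset.prod_ne_zero_iff.2 fun i _ => hA0 i) (hev.trans ?_)
  rw [← Finset.prod_mul_distrib]
  refine Finset.prod_congr rfl fun i _ => ?_
  rw [hA1, hB1]
  split_ifs
  · field_simp [hQ i]
  · field_simp [hμ i]
    ring

namespace MvPolynomial

lemma diagonalHom_pderiv {σ K : Type*} [Field K] {μ : σ → K} {f : MvPolynomial σ K}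
    (hf : diagonalHom μ f = f) {i : σ} (hμ : μ i ≠ 0) :
    diagonalHom μ (pderiv i f) = C (μ i)⁻¹ * pderiv i f := by
  ext m
  have h := congr_arg (coeff (m + Finsupp.single i 1)) hf
  rw [coeff_diagonalHom, Finsupp.prod_add_index' (by simp) (by simp [pow_add]),
    Finsupp.prod_single_index (by simp), pow_one] at h
  rw [coeff_diagonalHom, coeff_C_mul, coeff_pderiv, eq_inv_mul_iff_mul_eq₀ hμ, ← mul_assoc,
    ← mul_assoc, mul_comm (μ i), h]

/-- The trace of a diagonal symmetry on the Milnor ring, over any field of characteristic zero. -/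
theorem trace_jacobian_quotient {K : Type*} [Field K] [CharZero K] {n N : ℕ}
    {f : MvPolynomial (Fin n) K} {Q : Fin n → ℕ} (hQpos : ∀ i, 0 < Q i) (hQlt : ∀ i, Q i < N)
    (hf : IsWeightedHomogeneous Q f N) {μ : Fin n → K} (hμ : ∀ i, μ i ≠ 0)
    (hinv : diagonalHom μ f = f)
    [FiniteDimensional K (MvPolynomial (Fin n) K ⧸ Ideal.span (Set.range fun i => pderiv i f))]
    {φ : (MvPolynomial (Fin n) K ⧸ Ideal.span (Set.range fun i => pderiv i f)) →ₗ[K]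
      (MvPolynomial (Fin n) K ⧸ Ideal.span (Set.range fun i => pderiv i f))}
    (hφ : ∀ x, φ (Ideal.Quotient.mk _ x) = Ideal.Quotient.mk _ (diagonalHom μ x)) :
    LinearMap.trace K _ φ = ∏ i, if μ i = 1 then (N : K) / Q i - 1 else -(μ i)⁻¹ := by
  have hw (i) : Q i ≠ 0 := (hQpos i).ne'
  have hh (i) : IsWeightedHomogeneous Q (pderiv i f) (N - Q i) :=
    hf.pderiv (Nat.sub_add_cancel (hQlt i).le)
  have hc (i) : constantCoeff (pderiv i f) = 0 := by
    by_contra h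
    have h1 := hh i h
    have h2 := hQlt i
    rw [map_zero] at h1
    omega
  have hcomp : ∀ p ∈ Ideal.span (Set.range fun i => pderiv i f), ∀ d,
      weightedHomogeneousComponent Q d p ∈ Ideal.span (Set.range fun i => pderiv i f) :=
    fun p hp d => weightedHomogeneousComponent_mem_span
      (by rintro _ ⟨j, rfl⟩; exact ⟨_, hh j⟩) hp d
  have hpow := exists_X_pow_mem hw hcomp
  obtain ⟨D, hD⟩ := exists_forall_monomial_mem (w := Q) hpow
  have hreg := regular_of_pow_mem hw hh hc hpow
  have h0 (i) : pderiv i f ≠ 0 := by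
    intro h
    have h1 := hreg i 1 0 (isWeightedHomogeneous_one K Q) (by rw [h, zero_mul]; exact zero_mem _)
    have h2 : Ideal.span ((fun i => pderiv i f) '' Set.Iio i) ≤ RingHom.ker constantCoeff := by
      rw [Ideal.span_le]
      rintro _ ⟨j, -, rfl⟩
      exact hc j
    simpa using h2 h1
  obtain ⟨hJ, hseries⟩ := traceSeries_span_range hw h0 hh
    (fun i => diagonalHom_pderiv hinv (hμ i)) hreg
  obtain ⟨p, hp, hev⟩ := trace_quotient_eq_eval_traceSeries hw hJ hD hφ
  have hX := (traceSeries_span_range (w := Q) (μ := μ) hw (fun i => X_ne_zero i)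
    (isWeightedHomogeneous_X K Q) (fun i => aeval_X _ i)
    (fun i y _ _ hy => X_mul_mem_span_X_image (by simp) hy)).2
  rw [← ker_constantCoeff_eq_span_X, traceSeries_ker_constantCoeff hw] at hX
  rw [← hev]
  refine Polynomial.eval_one_eq_prod_of_mul_eq hQpos hQlt hμ (Polynomial.coe_injective K ?_)
  have hcoe (χ : Fin n → K) (e : Fin n → ℕ) :
      ((∏ i, (1 - Polynomial.C (χ i) * Polynomial.X ^ e i) : Polynomial K) : PowerSeries K) =
        ∏ i, (1 - PowerSeries.C (χ i) * PowerSeries.X ^ e i) := by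
    rw [← Polynomial.coeToPowerSeries.ringHom_apply, map_prod]
    simp
  rw [Polynomial.coe_mul, hcoe, hcoe, hp, hseries, mul_right_comm, ← hX, one_mul]

end MvPolynomial

/-- Let `f ∈ ℂ[x₁,…,xₙ]` be quasi-homogeneous of type `q = (Q₁/N, …, Qₙ/N)`
with `0 < qᵢ < 1` and finite-dimensional Milnor ring, and let `g = diag(μ₁,…,μₙ)` be a
diagonal symmetry of `f` of finite order.  Then the trace of the induced automorphism `φ_g`
of the Milnor ring equals `∏_{i : μᵢ ≠ 1} (−μᵢ⁻¹) · ∏_{i : μᵢ = 1} (1/qᵢ − 1)`; in particular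
it equals `(−1)^{|N_g|} det(g)⁻¹ · dim A_g` where `N_g = {i : μᵢ ≠ 1}` and
`dim A_g = ∏_{i : μᵢ = 1} (1/qᵢ − 1)`. -/
theorem trace_of_symmetry_on_milnor_ring
    (n : ℕ) (f : MvPolynomial (Fin n) ℂ)
    (N : ℕ) (Q : Fin n → ℕ) (hN : 0 < N)
    (hQpos : ∀ i, 0 < Q i) (hQlt : ∀ i, Q i < N)
    (hqh : ∀ m ∈ f.support, ∑ i, Q i * m i = N)
    (μ : Fin n → ℂ) (hord : ∃ m : ℕ, 0 < m ∧ ∀ i, μ i ^ m = 1)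
    (hinv : MvPolynomial.aeval (fun i => MvPolynomial.C (μ i) * MvPolynomial.X i) f = f)
    (Jf : Ideal (MvPolynomial (Fin n) ℂ))
    (hJf : Jf = Ideal.span (Set.range fun i => MvPolynomial.pderiv i f))
    (hfin : FiniteDimensional ℂ (MvPolynomial (Fin n) ℂ ⧸ Jf))
    (φg : (MvPolynomial (Fin n) ℂ ⧸ Jf) →ₗ[ℂ] (MvPolynomial (Fin n) ℂ ⧸ Jf))
    (hφg : ∀ x : MvPolynomial (Fin n) ℂ,
        φg (Ideal.Quotient.mk Jf x)
          = Ideal.Quotient.mk Jf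
              (MvPolynomial.aeval (fun i => MvPolynomial.C (μ i) * MvPolynomial.X i) x)) :
    LinearMap.trace ℂ (MvPolynomial (Fin n) ℂ ⧸ Jf) φg
        = (∏ i ∈ Finset.univ.filter (fun i => μ i ≠ 1), (-(μ i)⁻¹))
            * ∏ i ∈ Finset.univ.filter (fun i => μ i = 1), ((N : ℂ) / (Q i : ℂ) - 1) ∧
    LinearMap.trace ℂ (MvPolynomial (Fin n) ℂ ⧸ Jf) φg
        = (-1) ^ (Finset.univ.filter (fun i => μ i ≠ 1)).card * (∏ i, μ i)⁻¹
            * ∏ i ∈ Finset.univ.filter (fun i => μ i = 1), ((N : ℂ) / (Q i : ℂ) - 1) := by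
  have hμ (i) : μ i ≠ 0 := by
    obtain ⟨m, hm, h⟩ := hord
    intro h0
    simpa [h0, hm.ne'] using h i
  have hf : IsWeightedHomogeneous Q f N := by
    intro m hm
    rw [Finsupp.weight_apply, Finsupp.sum_fintype _ _ (by simp), ← hqh m (mem_support_iff.2 hm)]
    exact Finset.sum_congr rfl fun i _ => mul_comm _ _
  subst hJf
  have htr := trace_jacobian_quotient hQpos hQlt hf hμ hinv hφg
  rw [Finset.prod_ite, mul_comm] at htr
  refine ⟨htr, htr.trans ?_⟩
  congr 1
  rw [Finset.prod_neg, ← Finset.prod_inv_distrib]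
  congr 1
  refine Finset.prod_filter_of_ne fun i _ h h1 => h ?_
  rw [h1, inv_one]
end

section
/- Let A be a special G-Frobenius algebra in which every homogeneous component is one-dimensional: A_g = k·1_g for all g ∈ G (so in particular A_e = k·1). Identify each γ_{g,h} ∈ A_e with a scalar in k via γ_{g,h} = c_{g,h}·1. Then all c_{g,h} are nonzero, and c : G × G → k* is a 2-cocycle: c_{g,h} c_{gh,k} = c_{h,k} c_{g,hk} for all g, h, k ∈ G, with c_{e,g} = c_{g,e} = 1; hence A is a twisted group algebra of G over k with cocycle c. -/
namespace SpecialGFrobenius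

variable {k G A : Type*} [Field k] [Group G] [DecidableEq G] [AddCommGroup A] [Module k A]

theorem mul_oneg_inv_ne_zero (S : SpecialGFrobenius k G A)
    (hdim : ∀ g : G, S.grade g = Submodule.span k {S.oneg g}) (g : G) :
    S.mul (S.oneg g) (S.oneg g⁻¹) ≠ 0 := by
  intro h0
  refine S.oneg_ne g (S.eta_nondeg_left _ fun b => ?_)
  have hb : b ∈ ⨆ h, S.grade h := by
    rw [S.internal.submodule_iSup_eq_top]
    trivial
  induction hb using Submodule.iSup_induction' with
  | zero => simp
  | add x y _ _ hx hy => simp [hx, hy]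
  | mem h x hx =>
    by_cases hgh : g * h = 1
    · obtain rfl : h = g⁻¹ := eq_inv_of_mul_eq_one_right hgh
      rw [hdim, Submodule.mem_span_singleton] at hx
      obtain ⟨t, rfl⟩ := hx
      rw [← S.mul_one' (S.oneg g⁻¹), map_smul, S.eta_invariant, h0]
      simp
    · exact S.eta_grade g h hgh _ (S.oneg_mem g) _ hx

theorem mul_oneg_ne_zero (S : SpecialGFrobenius k G A)
    (hdim : ∀ g : G, S.grade g = Submodule.span k {S.oneg g}) (g h : G) :
    S.mul (S.oneg g) (S.oneg h) ≠ 0 := by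
  intro h0
  have hmem := S.mul_mem g⁻¹ g _ (S.oneg_mem _) _ (S.oneg_mem _)
  rw [inv_mul_cancel, hdim, S.oneg_one, Submodule.mem_span_singleton] at hmem
  obtain ⟨s, hs⟩ := hmem
  have hs0 : s ≠ 0 := by
    rintro rfl
    have := S.mul_oneg_inv_ne_zero hdim g⁻¹
    rw [inv_inv, ← hs, zero_smul] at this
    exact this rfl
  have key := S.mul_assoc' (S.oneg g⁻¹) (S.oneg g) (S.oneg h)
  rw [h0, ← hs, map_smul, LinearMap.smul_apply, S.one_mul', map_zero] at key
  exact smul_ne_zero hs0 (S.oneg_ne h) key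

theorem iota_oneg (S : SpecialGFrobenius k G A)
    (hdim : ∀ g : G, S.grade g = Submodule.span k {S.oneg g}) (g : G) :
    S.iota g (S.oneg g) = S.one := by
  have hmem := S.iota_mem g _ (S.oneg_mem g)
  rw [hdim, S.oneg_one, Submodule.mem_span_singleton] at hmem
  obtain ⟨t, ht⟩ := hmem
  have hsec := S.iota_section g _ (S.oneg_mem g)
  rw [← ht, map_smul, LinearMap.smul_apply, S.one_mul'] at hsec
  have ht1 : t = 1 := smul_left_injective k (S.oneg_ne g) (by simpa using hsec)
  rw [← ht, ht1, one_smul]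

end SpecialGFrobenius

/-- a special `G`-Frobenius algebra all of whose homogeneous components are
one-dimensional (`A_g = k·1_g`) is a twisted group algebra: the `γ_{g,h}` are given by nonzero
scalars `c_{g,h}` forming a `2`-cocycle `c : G × G → k*` with `1_g ∘ 1_h = c_{g,h}·1_{gh}`. -/
theorem one_dimensional_sectors_twisted_group_algebra
    {k G A : Type*} [Field k] [CharZero k] [Group G] [DecidableEq G] [Fintype G]
    [AddCommGroup A] [Module k A] (S : SpecialGFrobenius k G A)
    (hdim : ∀ g : G, S.grade g = Submodule.span k {S.oneg g}) :
    ∃ c : G → G → k,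
      (∀ g h : G, S.gam g h = c g h • S.one) ∧
      (∀ g h : G, c g h ≠ 0) ∧
      (∀ g h l : G, c g h * c (g * h) l = c h l * c g (h * l)) ∧
      (∀ g : G, c 1 g = 1 ∧ c g 1 = 1) ∧
      (∀ g h : G, S.mul (S.oneg g) (S.oneg h) = c g h • S.oneg (g * h)) := by
  have hex : ∀ g h : G, ∃ c : k, c • S.oneg (g * h) = S.mul (S.oneg g) (S.oneg h) := fun g h => by
    rw [← Submodule.mem_span_singleton, ← hdim]
    exact S.mul_mem g h _ (S.oneg_mem g) _ (S.oneg_mem h)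
  choose c hc using hex
  refine ⟨c, fun g h => ?_, fun g h h0 => ?_, fun g h l => ?_, fun g => ⟨?_, ?_⟩,
    fun g h => (hc g h).symm⟩
  · rw [SpecialGFrobenius.gam, ← hc, map_smul, S.iota_oneg hdim]
  · apply S.mul_oneg_ne_zero hdim g h
    rw [← hc, h0, zero_smul]
  · apply smul_left_injective k (S.oneg_ne (g * h * l))
    have key := S.mul_assoc' (S.oneg g) (S.oneg h) (S.oneg l)
    rw [← hc g h, ← hc h l, map_smul, map_smul, LinearMap.smul_apply, ← hc, ← hc, smul_smul,
      smul_smul, ← mul_assoc g h l] at key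
    exact key
  · apply smul_left_injective k (S.oneg_ne g)
    have key := hc 1 g
    rw [one_mul, S.oneg_one, S.one_mul'] at key
    simpa using key
  · apply smul_left_injective k (S.oneg_ne g)
    have key := hc g 1
    rw [mul_one, S.oneg_one, S.mul_one'] at key
    simpa using key
end
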